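/- arXiv:1411.5619 — 2 statements merged into one kernel-verified Lean document; each statement's English description precedes it below -/
import Mathlib

section
/- Let A be a separable C*-algebra. A projection P in the bidual A** is a projection in the multiplier algebra M(A) if and only if P is the strict limit of an increasing net of positive elements of A. Consequently every projection in M(A) is an open projection; in particular, the projections of M(A⊗K) form a subset of the open projections in (A⊗K)**. -/
open Filter Topology

namespace CuntzOP



variable {H : Type*} [NormedAddCommGroup H] [InnerProductSpace ℂ H] [CompleteSpace H]

/-- The Loewner order on bounded operators on a Hilbert space. -/
def opLE (a b : H →L[ℂ] H) : Prop := (b - a).IsPositive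

/-- `A` is a (not necessarily unital) norm-closed *-subalgebra of `B(H)`,
i.e. a concrete C*-algebra. -/
def IsCStarSubalg (A : Set (H →L[ℂ] H)) : Prop :=
  (0 : H →L[ℂ] H) ∈ A ∧ (∀ x ∈ A, ∀ y ∈ A, x + y ∈ A) ∧
    (∀ (c : ℂ), ∀ x ∈ A, c • x ∈ A) ∧ (∀ x ∈ A, ∀ y ∈ A, x * y ∈ A) ∧
    (∀ x ∈ A, star x ∈ A) ∧ IsClosed A

/-- `A` acts nondegenerately on `H` (as in the universal representation). -/
def Nondegenerate (A : Set (H →L[ℂ] H)) : Prop :=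
  ∀ x : H, ∀ ε : ℝ, 0 < ε → ∃ a ∈ A, ‖a x - x‖ < ε

/-- The closure of a set of operators in the strong operator topology.  For a
C*-algebra `A` in its universal representation, `sotClosure A` is identified with
the bidual `A**`. -/
def sotClosure (S : Set (H →L[ℂ] H)) : Set (H →L[ℂ] H) :=
  {T | ∀ ε : ℝ, 0 < ε → ∀ v : Finset H, ∃ s ∈ S, ∀ x ∈ v, ‖T x - s x‖ < ε}

/-- An orthogonal projection (self-adjoint idempotent). -/
def IsProjectionOp (p : H →L[ℂ] H) : Prop := IsSelfAdjoint p ∧ IsIdempotentElem p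

/-- Convergence of a sequence of operators in the strong operator topology. -/
def SOTTendsto (T : ℕ → H →L[ℂ] H) (S : H →L[ℂ] H) : Prop :=
  ∀ x : H, Tendsto (fun n => T n x) atTop (𝓝 (S x))

/-- A projection `p ∈ A**` is open if it is the strong limit of an increasing net of
positive elements of `A`. -/
def IsOpenProjection (A : Set (H →L[ℂ] H)) (p : H →L[ℂ] H) : Prop :=
  IsProjectionOp p ∧
    ∃ (ι : Type) (le : ι → ι → Prop) (a : ι → H →L[ℂ] H),
      Nonempty ι ∧ (∀ i, le i i) ∧ (∀ i j k, le i j → le j k → le i k) ∧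
      (∀ i j, ∃ k, le i k ∧ le j k) ∧
      (∀ i, a i ∈ A) ∧ (∀ i, (a i).IsPositive) ∧
      (∀ i j, le i j → opLE (a i) (a j)) ∧
      ∀ x : H, ∀ ε : ℝ, 0 < ε → ∃ i, ∀ j, le i j → ‖a j x - p x‖ < ε

/-- The hereditary subalgebra `A_p = pA**p ∩ A = pAp ∩ A` associated to a projection
`p ∈ A**`. -/
def her (A : Set (H →L[ℂ] H)) (p : H →L[ℂ] H) : Set (H →L[ℂ] H) :=
  {a | a ∈ A ∧ p * a * p = a}

/-- A projection is closed if its complement is open. -/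
def IsClosedProjection (A : Set (H →L[ℂ] H)) (p : H →L[ℂ] H) : Prop :=
  IsProjectionOp p ∧ IsOpenProjection A (1 - p)

/-- `c` is the closure `p̄` of the open projection `p`: the least closed projection
dominating `p`. -/
def IsClosureOf (A : Set (H →L[ℂ] H)) (p c : H →L[ℂ] H) : Prop :=
  IsClosedProjection A c ∧ opLE p c ∧
    ∀ q, IsClosedProjection A q → opLE p q → opLE c q

/-- Compact containment `p ⊂⊂ q` of open projections: the closure of `p` is compact in
`A_q`, i.e. `p̄ a = p̄` for some positive contraction `a ∈ A_q`. -/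
def IsCompactlyContained (A : Set (H →L[ℂ] H)) (p q : H →L[ℂ] H) : Prop :=
  ∃ c, IsClosureOf A p c ∧ ∃ a ∈ her A q, a.IsPositive ∧ ‖a‖ ≤ 1 ∧ c * a = c

/-- Peligrad–Zsidó equivalence of open projections. -/
def PZEquiv (A : Set (H →L[ℂ] H)) (p q : H →L[ℂ] H) : Prop :=
  ∃ v ∈ sotClosure A, star v * v = p ∧ v * star v = q ∧
    (∀ a ∈ her A p, v * a ∈ A) ∧ ∀ a ∈ her A q, star v * a ∈ A

/-- Cuntz subequivalence of open projections: `p ≾ q` iff every `p' ⊂⊂ p` is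
PZ-equivalent to some `q' ⊂⊂ q`. -/
def CuLE (A : Set (H →L[ℂ] H)) (p q : H →L[ℂ] H) : Prop :=
  ∀ p', IsOpenProjection A p' → IsCompactlyContained A p' p →
    ∃ q', IsOpenProjection A q' ∧ IsCompactlyContained A q' q ∧ PZEquiv A p' q'

/-- Cuntz equivalence of open projections. -/
def CuEquiv (A : Set (H →L[ℂ] H)) (p q : H →L[ℂ] H) : Prop :=
  CuLE A p q ∧ CuLE A q p

/-- Compact subequivalence `p ≺≺ q`: `p` is PZ-equivalent to some `q' ⊂⊂ q`. -/
def CompactSubequiv (A : Set (H →L[ℂ] H)) (p q : H →L[ℂ] H) : Prop :=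
  ∃ q', IsOpenProjection A q' ∧ IsCompactlyContained A q' q ∧ PZEquiv A p q'

/-- The multiplier algebra of `A`, concretely realized (for a nondegenerate
representation) as the idealizer of `A` in `B(H)`. -/
def multiplierSet (A : Set (H →L[ℂ] H)) : Set (H →L[ℂ] H) :=
  {x | ∀ a ∈ A, x * a ∈ A ∧ a * x ∈ A}

/-- Convergence of a net of operators in the strict topology determined by `A`. -/
def StrictTendsto (A : Set (H →L[ℂ] H)) {ι : Type*} (le : ι → ι → Prop)
    (a : ι → H →L[ℂ] H) (x : H →L[ℂ] H) : Prop :=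
  ∀ b ∈ A, ∀ ε : ℝ, 0 < ε → ∃ i, ∀ j, le i j →
    ‖a j * b - x * b‖ < ε ∧ ‖b * a j - b * x‖ < ε

/-- `A` is stable (i.e. of the form `A₀ ⊗ K`): there is a sequence of isometries in
`M(A)` with pairwise orthogonal ranges adding up strictly to the identity. -/
def IsStableAlg (A : Set (H →L[ℂ] H)) : Prop :=
  ∃ s : ℕ → H →L[ℂ] H, (∀ n, s n ∈ multiplierSet A) ∧
    (∀ n, star (s n) * s n = 1) ∧ (∀ m n, m ≠ n → star (s m) * s n = 0) ∧
    StrictTendsto A (· ≤ ·) (fun N => ∑ n ∈ Finset.range N, s n * star (s n)) 1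

/-- A *-isomorphism between two (concrete) C*-algebras given as subsets of `B(H)`. -/
def StarAlgEquivOn (S T : Set (H →L[ℂ] H)) : Prop :=
  ∃ f : (H →L[ℂ] H) → (H →L[ℂ] H), Set.BijOn f S T ∧
    (∀ x ∈ S, ∀ y ∈ S, f (x + y) = f x + f y) ∧
    (∀ x ∈ S, ∀ y ∈ S, f (x * y) = f x * f y) ∧
    (∀ (c : ℂ), ∀ x ∈ S, f (c • x) = c • f x) ∧
    ∀ x ∈ S, f (star x) = star (f x)

/-- A hereditary sub-C*-algebra of `A`. -/
def IsHereditarySubalg (A C : Set (H →L[ℂ] H)) : Prop :=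
  C ⊆ A ∧ IsClosed C ∧ (0 : H →L[ℂ] H) ∈ C ∧
    (∀ x ∈ C, ∀ y ∈ C, x + y ∈ C) ∧ (∀ (c : ℂ), ∀ x ∈ C, c • x ∈ C) ∧
    (∀ x ∈ C, ∀ y ∈ C, x * y ∈ C) ∧ (∀ x ∈ C, star x ∈ C) ∧
    ∀ x ∈ C, ∀ a ∈ A, ∀ y ∈ C, x * a * y ∈ C




lemma seq_approx_unit {B : Type*} [NonUnitalCStarAlgebra B] [PartialOrder B] [StarOrderedRing B]
    [TopologicalSpace.SeparableSpace B] :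
    ∃ u : ℕ → B, Monotone u ∧ (∀ n, 0 ≤ u n) ∧ (∀ n, ‖u n‖ ≤ 1) ∧
      ∀ b, Tendsto (fun n => u n * b) atTop (𝓝 b) := by
  classical
  let d := TopologicalSpace.denseSeq B
  let S := {y : B // 0 ≤ y ∧ ‖y‖ < 1}
  have step : ∀ (n : ℕ) (y : S), ∃ z : S, y.1 ≤ z.1 ∧
      ∀ k ∈ Finset.range (n+1), ‖z.1 * d k - d k‖ < 1 / ((n : ℝ) + 1) := by
    intro n y
    have hev : ∀ᶠ x in CStarAlgebra.approximateUnit B, ∀ k ∈ Finset.range (n+1),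
        ‖x * d k - d k‖ < 1 / ((n : ℝ) + 1) := by
      rw [Filter.eventually_all_finset]
      intro k _
      have h := (CStarAlgebra.increasingApproximateUnit B).tendsto_mul_right (d k)
      have := (Metric.tendsto_nhds.1 h) (1 / ((n : ℝ) + 1)) (by positivity)
      simpa only [dist_eq_norm] using this
    obtain ⟨w, hw, hw2⟩ := (CStarAlgebra.hasBasis_approximateUnit B).eventually_iff.1 hev
    obtain ⟨z, hz, h1, h2⟩ := CStarAlgebra.directedOn_nonneg_ball w
      (by simpa using hw) y.1 (by simpa using y.2)
    have hz' : 0 ≤ z ∧ ‖z‖ < 1 := by simpa using hz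
    exact ⟨⟨z, hz'⟩, h2, hw2 ⟨h1, by simpa using hz'.2.le⟩⟩
  choose f hf1 hf2 using step
  let u : ℕ → S := fun n => Nat.rec ⟨0, le_rfl, by simp⟩ (fun n y => f n y) n
  refine ⟨fun n => (u n).1, monotone_nat_of_le_succ fun n => hf1 n (u n), fun n => (u n).2.1,
    fun n => (u n).2.2.le, fun b => ?_⟩
  rw [Metric.tendsto_atTop]
  intro ε hε
  obtain ⟨k, hk⟩ : ∃ k, dist b (d k) < ε / 3 :=
    (TopologicalSpace.denseRange_denseSeq B).exists_dist_lt b (by positivity)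
  obtain ⟨m, hm⟩ := exists_nat_one_div_lt (show (0:ℝ) < ε / 3 by positivity)
  refine ⟨max m k + 1, fun n hn => ?_⟩
  obtain ⟨n, rfl⟩ : ∃ n', n = n' + 1 := ⟨n - 1, by omega⟩
  have hn' : max m k ≤ n := by omega
  have h1 : ‖(u (n+1)).1 * d k - d k‖ < ε / 3 := by
    refine lt_of_lt_of_le (hf2 n (u n) k ?_) (le_trans ?_ hm.le)
    · have := le_max_right m k
      simp; omega
    · have : (m : ℝ) ≤ n := by exact_mod_cast (le_max_left m k).trans hn'
      gcongr
  have h2 : ‖(u (n+1)).1 * (b - d k)‖ < ε / 3 := by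
    rw [dist_eq_norm] at hk
    refine lt_of_le_of_lt (norm_mul_le _ _) (lt_of_le_of_lt ?_ hk)
    exact mul_le_of_le_one_left (norm_nonneg _) (u (n+1)).2.2.le
  rw [dist_eq_norm] at hk ⊢
  have e : (u (n+1)).1 * b - b = (u (n+1)).1 * (b - d k) + ((u (n+1)).1 * d k - d k)
      - (b - d k) := by rw [mul_sub]; abel
  rw [e]
  have := norm_sub_le ((u (n+1)).1 * (b - d k) + ((u (n+1)).1 * d k - d k)) (b - d k)
  have := norm_add_le ((u (n+1)).1 * (b - d k)) ((u (n+1)).1 * d k - d k)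
  linarith

lemma seq_approx_unit_unordered {B : Type*} [NonUnitalCStarAlgebra B]
    [TopologicalSpace.SeparableSpace B] :
    ∃ u : ℕ → B, (∀ m n, m ≤ n → ∃ s, u n - u m = star s * s) ∧ (∀ n, ∃ s, u n = star s * s) ∧
      (∀ n, ‖u n‖ ≤ 1) ∧ ∀ b, Tendsto (fun n => u n * b) atTop (𝓝 b) := by
  let _ : PartialOrder B := CStarAlgebra.spectralOrder B
  have : StarOrderedRing B := CStarAlgebra.spectralOrderedRing B
  obtain ⟨u, hmono, hpos, hnorm, hlim⟩ := seq_approx_unit (B := B)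
  exact ⟨u, fun m n h => CStarAlgebra.nonneg_iff_eq_star_mul_self.1 (sub_nonneg.2 (hmono h)),
    fun n => CStarAlgebra.nonneg_iff_eq_star_mul_self.1 (hpos n), hnorm, hlim⟩

/-- The corner `PAP` as a star subalgebra. -/
def corner {H : Type*} [NormedAddCommGroup H] [InnerProductSpace ℂ H] [CompleteSpace H]
    (A : Set (H →L[ℂ] H)) (hA : IsCStarSubalg A) (P : H →L[ℂ] H) (hP : IsProjectionOp P) :
    NonUnitalStarSubalgebra ℂ (H →L[ℂ] H) where
  carrier := {a | a ∈ A ∧ P * a = a ∧ a * P = a}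
  zero_mem' := ⟨hA.1, by simp, by simp⟩
  add_mem' := by
    rintro a b ⟨h1, h2, h3⟩ ⟨g1, g2, g3⟩
    exact ⟨hA.2.1 _ h1 _ g1, by rw [mul_add, h2, g2], by rw [add_mul, h3, g3]⟩
  smul_mem' := by
    rintro c a ⟨h1, h2, h3⟩
    exact ⟨hA.2.2.1 c _ h1, by rw [mul_smul_comm, h2], by rw [smul_mul_assoc, h3]⟩
  mul_mem' := by
    rintro a b ⟨h1, h2, h3⟩ ⟨g1, g2, g3⟩
    exact ⟨hA.2.2.2.1 _ h1 _ g1, by rw [← mul_assoc, h2], by rw [mul_assoc, g3]⟩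
  star_mem' := by
    rintro a ⟨h1, h2, h3⟩
    refine ⟨hA.2.2.2.2.1 _ h1, ?_, ?_⟩
    · rw [← hP.1.star_eq, ← star_mul, h3]
    · rw [← hP.1.star_eq, ← star_mul, h2]

lemma key {H : Type*} [NormedAddCommGroup H] [InnerProductSpace ℂ H] [CompleteSpace H]
    (A : Set (H →L[ℂ] H)) (hA : IsCStarSubalg A)
    (hsep : TopologicalSpace.IsSeparable A) (P : H →L[ℂ] H) (hP : IsProjectionOp P)
    (hM : P ∈ multiplierSet A) :
    ∃ a : ℕ → H →L[ℂ] H, (∀ n, a n ∈ A) ∧ (∀ n, (a n).IsPositive) ∧ (∀ n, ‖a n‖ ≤ 1) ∧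
      (∀ m n, m ≤ n → opLE (a m) (a n)) ∧ StrictTendsto A (· ≤ ·) a P := by
  let B := corner A hA P hP
  have hBA : (B : Set (H →L[ℂ] H)) ⊆ A := fun x hx => hx.1
  have hcl : IsClosed (B : Set (H →L[ℂ] H)) := by
    have h2 : IsClosed {a : H →L[ℂ] H | P * a = a} :=
      isClosed_eq (by fun_prop) (by fun_prop)
    have h3 : IsClosed {a : H →L[ℂ] H | a * P = a} :=
      isClosed_eq (by fun_prop) (by fun_prop)
    exact hA.2.2.2.2.2.inter (h2.inter h3)
  have : TopologicalSpace.SeparableSpace B := (hsep.mono hBA).separableSpace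
  obtain ⟨u, hmono, hpos, hnorm, hlim⟩ := seq_approx_unit_unordered (B := B)
  have hpp : ∀ x : B, (∃ s, x = star s * s) → (x : H →L[ℂ] H).IsPositive := by
    intro x hx
    obtain ⟨s, hs⟩ := hx
    rw [hs]
    exact ContinuousLinearMap.isPositive_adjoint_comp_self (s : H →L[ℂ] H)
  have hsa : ∀ n, star (u n : H →L[ℂ] H) = u n := fun n => (hpp _ (hpos n)).isSelfAdjoint.star_eq
  have hP1 : ‖P‖ ≤ 1 := by
    have h := CStarRing.norm_star_mul_self (x := P)
    rw [hP.1.star_eq, hP.2.eq] at h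
    nlinarith [norm_nonneg P, sq_nonneg (‖P‖ - 1)]
  -- main convergence
  have hR : ∀ b ∈ A, Tendsto (fun n => (u n : H →L[ℂ] H) * b) atTop (𝓝 (P * b)) := by
    intro b hb
    let c : H →L[ℂ] H := P * b * star b * P
    have hc : c ∈ B := by
      refine ⟨?_, ?_, ?_⟩
      · exact (hM _ (hA.2.2.2.1 _ (hM b hb).1 _ (hA.2.2.2.2.1 _ hb))).2
      · simp only [c, ← mul_assoc]; rw [hP.2.eq]
      · simp only [c, mul_assoc]; rw [hP.2.eq]
    have h0 := (continuous_subtype_val.tendsto _).comp (hlim ⟨c, hc⟩)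
    have h0' : Tendsto (fun n => (u n : H →L[ℂ] H) * c) atTop (𝓝 c) := h0
    have h1 : Tendsto (fun n => 2 * ‖(u n : H →L[ℂ] H) * c - c‖) atTop (𝓝 0) := by
      have := (tendsto_iff_norm_sub_tendsto_zero.1 h0').const_mul 2
      simpa using this
    rw [tendsto_iff_norm_sub_tendsto_zero]
    have h2 : ∀ n, ‖(u n : H →L[ℂ] H) * b - P * b‖ ^ 2 ≤ 2 * ‖(u n : H →L[ℂ] H) * c - c‖ := by
      intro n
      have huP : (u n : H →L[ℂ] H) * P = u n := (u n).2.2.2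
      have hPu : P * (u n : H →L[ℂ] H) = u n := (u n).2.2.1
      have e : ((u n : H →L[ℂ] H) * b - P * b) * star ((u n : H →L[ℂ] H) * b - P * b)
          = ((u n : H →L[ℂ] H) * c - c) * ((u n : H →L[ℂ] H) - P) := by
        have e1 : (u n : H →L[ℂ] H) * c = u n * b * star b * P := by
          simp only [c, ← mul_assoc]; rw [huP]
        rw [e1]
        simp only [c, star_sub, star_mul, hsa, hP.1.star_eq, sub_mul, mul_sub, mul_assoc,
          hPu, hP.2.eq]
      rw [sq, ← CStarRing.norm_self_mul_star, e, mul_comm 2]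
      refine (norm_mul_le _ _).trans ?_
      gcongr
      have := norm_sub_le (u n : H →L[ℂ] H) P
      have h5 : ‖(u n : H →L[ℂ] H)‖ ≤ 1 := hnorm n
      linarith
    have h3 : Tendsto (fun n => ‖(u n : H →L[ℂ] H) * b - P * b‖ ^ 2) atTop (𝓝 0) :=
      squeeze_zero (fun n => by positivity) h2 h1
    have h4 := (Real.continuous_sqrt.tendsto 0).comp h3
    simpa [Function.comp_def, Real.sqrt_sq] using h4
  have hL : ∀ b ∈ A, Tendsto (fun n => b * (u n : H →L[ℂ] H)) atTop (𝓝 (b * P)) := by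
    intro b hb
    have := (continuous_star.tendsto _).comp (hR (star b) (hA.2.2.2.2.1 _ hb))
    simpa [Function.comp_def, hsa, hP.1.star_eq] using this
  refine ⟨fun n => u n, fun n => (u n).2.1, fun n => hpp _ (hpos n), fun n => hnorm n, ?_, ?_⟩
  · intro m n hmn
    exact hpp (u n - u m) (hmono m n hmn)
  · intro b hb ε hε
    have r := Metric.tendsto_nhds.1 (hR b hb) ε hε
    have l := Metric.tendsto_nhds.1 (hL b hb) ε hε
    obtain ⟨i, hi⟩ := eventually_atTop.1 (r.and l)
    exact ⟨i, fun j hj => by simpa only [dist_eq_norm] using hi j hj⟩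

/-- Let `A` be a separable C*-algebra (realized nondegenerately on a
Hilbert space, e.g. via its universal representation, so that `sotClosure A = A**` and
`multiplierSet A = M(A)`).  A projection `P ∈ A**` belongs to `M(A)` if and only if `P`
is the strict limit of an increasing net of positive elements of `A`.  Consequently,
every projection in `M(A)` is an open projection; in particular (applying this to
`A ⊗ K`) the projections of `M(A ⊗ K)` form a subset of the open projections of
`(A ⊗ K)**`. -/
theorem multiplier_projections_are_strict_limits_and_open
    {H : Type*} [NormedAddCommGroup H] [InnerProductSpace ℂ H] [CompleteSpace H]
    (A : Set (H →L[ℂ] H)) (hA : IsCStarSubalg A)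
    (hsep : TopologicalSpace.IsSeparable A) (hnd : Nondegenerate A) :
    (∀ P : H →L[ℂ] H, IsProjectionOp P → P ∈ sotClosure A →
      (P ∈ multiplierSet A ↔
        ∃ (ι : Type) (le : ι → ι → Prop) (a : ι → H →L[ℂ] H),
          Nonempty ι ∧ (∀ i, le i i) ∧ (∀ i j k, le i j → le j k → le i k) ∧
          (∀ i j, ∃ k, le i k ∧ le j k) ∧
          (∀ i, a i ∈ A) ∧ (∀ i, (a i).IsPositive) ∧
          (∀ i j, le i j → opLE (a i) (a j)) ∧
          StrictTendsto A le a P)) ∧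
    (∀ P : H →L[ℂ] H, IsProjectionOp P → P ∈ multiplierSet A →
      IsOpenProjection A P) ∧
    {P : H →L[ℂ] H | IsProjectionOp P ∧ P ∈ multiplierSet A} ⊆
      {P : H →L[ℂ] H | IsOpenProjection A P} := by
  have hopen : ∀ P : H →L[ℂ] H, IsProjectionOp P → P ∈ multiplierSet A →
      IsOpenProjection A P := by
    intro P hP hM
    obtain ⟨a, h1, h2, h3, h4, h5⟩ := key A hA hsep P hP hM
    refine ⟨hP, ℕ, (· ≤ ·), a, ⟨0⟩, le_refl, fun _ _ _ => le_trans,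
      fun i j => ⟨max i j, le_max_left _ _, le_max_right _ _⟩, h1, h2, h4, ?_⟩
    intro x ε hε
    have hC : 0 < 1 + ‖P‖ := by positivity
    obtain ⟨b, hb, hbx⟩ := hnd x (ε / 2 / (1 + ‖P‖)) (by positivity)
    obtain ⟨i, hi⟩ := h5 b hb (ε / 2 / (1 + ‖x‖)) (by positivity)
    refine ⟨i, fun j hj => ?_⟩
    have e : a j x - P x = (a j * b - P * b) x - (a j - P) (b x - x) := by
      simp
      abel
    have k1 : ‖(a j * b - P * b) x‖ ≤ ε / 2 := by
      refine (ContinuousLinearMap.le_opNorm _ _).trans ?_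
      have := (hi j hj).1.le
      rw [le_div_iff₀ (by positivity)] at this
      nlinarith [norm_nonneg (a j * b - P * b), norm_nonneg x]
    have k2 : ‖(a j - P) (b x - x)‖ < ε / 2 := by
      refine (ContinuousLinearMap.le_opNorm _ _).trans_lt ?_
      rw [lt_div_iff₀ hC] at hbx
      have g1 : ‖a j - P‖ ≤ 1 + ‖P‖ := (norm_sub_le _ _).trans (by linarith [h3 j])
      nlinarith [norm_nonneg (b x - x)]
    rw [e]
    exact (norm_sub_le _ _).trans_lt (by linarith)
  refine ⟨fun P hP _ => ⟨fun hM => ?_, ?_⟩, hopen, fun P hP => hopen P hP.1 hP.2⟩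
  · obtain ⟨a, h1, h2, h3, h4, h5⟩ := key A hA hsep P hP hM
    exact ⟨ℕ, (· ≤ ·), a, ⟨0⟩, le_refl, fun _ _ _ => le_trans,
      fun i j => ⟨max i j, le_max_left _ _, le_max_right _ _⟩, h1, h2, h4, h5⟩
  · rintro ⟨ι, le, a, -, hrefl, -, -, hmem, -, -, hst⟩ b hb
    constructor
    · rw [← hA.2.2.2.2.2.closure_eq]
      refine Metric.mem_closure_iff.2 fun ε hε => ?_
      obtain ⟨i, hi⟩ := hst b hb ε hε
      exact ⟨a i * b, hA.2.2.2.1 _ (hmem i) _ hb, by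
        rw [dist_comm, dist_eq_norm]; exact (hi i (hrefl i)).1⟩
    · rw [← hA.2.2.2.2.2.closure_eq]
      refine Metric.mem_closure_iff.2 fun ε hε => ?_
      obtain ⟨i, hi⟩ := hst b hb ε hε
      exact ⟨b * a i, hA.2.2.2.1 _ hb _ (hmem i), by
        rw [dist_comm, dist_eq_norm]; exact (hi i (hrefl i)).2⟩

end CuntzOP
end

section
/- Let A be a separable C*-algebra. Every sequence (p_n) of open projections in (A⊗K)** satisfying p_n ≺≺ p_{n+1} (compact subequivalence) for every n ∈ ℕ has a supremum of its classes [p_n] in Cu(A). -/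
open Filter Topology

namespace CuntzOP

variable {H : Type*} [NormedAddCommGroup H] [InnerProductSpace ℂ H] [CompleteSpace H]

theorem IsCStarSubalg.zero_mem {B : Set (H →L[ℂ] H)} (hB : IsCStarSubalg B) : (0 : H →L[ℂ] H) ∈ B := hB.1
theorem IsCStarSubalg.add_mem {B : Set (H →L[ℂ] H)} (hB : IsCStarSubalg B) {x y : H →L[ℂ] H}
    (hx : x ∈ B) (hy : y ∈ B) : x + y ∈ B := hB.2.1 x hx y hy
theorem IsCStarSubalg.smul_mem {B : Set (H →L[ℂ] H)} (hB : IsCStarSubalg B) (c : ℂ) {x : H →L[ℂ] H}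
    (hx : x ∈ B) : c • x ∈ B := hB.2.2.1 c x hx
theorem IsCStarSubalg.mul_mem {B : Set (H →L[ℂ] H)} (hB : IsCStarSubalg B) {x y : H →L[ℂ] H}
    (hx : x ∈ B) (hy : y ∈ B) : x * y ∈ B := hB.2.2.2.1 x hx y hy
theorem IsCStarSubalg.star_mem {B : Set (H →L[ℂ] H)} (hB : IsCStarSubalg B) {x : H →L[ℂ] H}
    (hx : x ∈ B) : star x ∈ B := hB.2.2.2.2.1 x hx
theorem IsCStarSubalg.isClosed {B : Set (H →L[ℂ] H)} (hB : IsCStarSubalg B) : IsClosed B :=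
  hB.2.2.2.2.2
theorem IsCStarSubalg.sub_mem {B : Set (H →L[ℂ] H)} (hB : IsCStarSubalg B) {x y : H →L[ℂ] H}
    (hx : x ∈ B) (hy : y ∈ B) : x - y ∈ B := by
  have := hB.add_mem hx (hB.smul_mem (-1) hy)
  simpa [sub_eq_add_neg] using this

/-- `B` as a non-unital star subalgebra. -/
def bAlg (B : Set (H →L[ℂ] H)) (hB : IsCStarSubalg B) : NonUnitalStarSubalgebra ℂ (H →L[ℂ] H) where
  carrier := B
  add_mem' := fun hx hy => hB.add_mem hx hy
  zero_mem' := hB.zero_mem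
  mul_mem' := fun hx hy => hB.mul_mem hx hy
  smul_mem' := fun c _ hx => hB.smul_mem c hx
  star_mem' := fun hx => hB.star_mem hx

/-- The multiplier algebra as a star subalgebra. -/
def mAlg (B : Set (H →L[ℂ] H)) (hB : IsCStarSubalg B) : StarSubalgebra ℂ (H →L[ℂ] H) where
  carrier := multiplierSet B
  add_mem' := fun hx hy a ha => ⟨by rw [add_mul]; exact hB.add_mem (hx a ha).1 (hy a ha).1,
    by rw [mul_add]; exact hB.add_mem (hx a ha).2 (hy a ha).2⟩
  zero_mem' := fun a ha => by simp [hB.zero_mem]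
  mul_mem' := fun {x y} hx hy a ha => ⟨by rw [mul_assoc]; exact (hx _ (hy a ha).1).1,
    by rw [← mul_assoc]; exact (hy _ (hx a ha).2).2⟩
  one_mem' := fun a ha => by simpa using ha
  algebraMap_mem' := fun c a ha => by
    simp only [Algebra.algebraMap_eq_smul_one, smul_mul_assoc, one_mul, mul_smul_comm, mul_one]
    exact ⟨hB.smul_mem c ha, hB.smul_mem c ha⟩
  star_mem' := fun {x} hx a ha => by
    have h := hx _ (hB.star_mem ha)
    refine ⟨?_, ?_⟩
    · simpa using hB.star_mem h.2
    · simpa using hB.star_mem h.1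

theorem multiplierSet_closed {B : Set (H →L[ℂ] H)} (hB : IsCStarSubalg B) :
    IsClosed (multiplierSet B) := by
  have : multiplierSet B = ⋂ a ∈ B, ({x | x * a ∈ B} ∩ {x | a * x ∈ B}) := by
    ext x; simp [multiplierSet]
  rw [this]
  refine isClosed_biInter fun a _ => IsClosed.inter ?_ ?_
  · exact hB.isClosed.preimage (continuous_id.mul continuous_const)
  · exact hB.isClosed.preimage (continuous_const.mul continuous_id)

theorem mem_mult {B : Set (H →L[ℂ] H)} (hB : IsCStarSubalg B) {x : H →L[ℂ] H}
    (hx : x ∈ B) : x ∈ multiplierSet B := fun _ ha => ⟨hB.mul_mem hx ha, hB.mul_mem ha hx⟩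

theorem cfc_mult {B : Set (H →L[ℂ] H)} (hB : IsCStarSubalg B) (f : ℝ → ℝ) {x : H →L[ℂ] H}
    (hx : x ∈ B) : cfc f x ∈ multiplierSet B := by
  have : IsClosed ((mAlg B hB : StarSubalgebra ℂ (H →L[ℂ] H)) : Set (H →L[ℂ] H)) :=
    multiplierSet_closed hB
  exact cfc_mem (𝕜' := ℂ) (s := mAlg B hB) f (mem_mult hB hx)

theorem exists_sqrt {B : Set (H →L[ℂ] H)} (hB : IsCStarSubalg B) {e : H →L[ℂ] H}
    (he : e ∈ B) (h0 : 0 ≤ e) : ∃ g ∈ B, star g * g = e := by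
  have : IsClosed ((bAlg B hB : NonUnitalStarSubalgebra ℂ (H →L[ℂ] H)) : Set (H →L[ℂ] H)) :=
    hB.isClosed
  refine ⟨CFC.sqrt e, ?_, ?_⟩
  · rw [CFC.sqrt_eq_real_sqrt e]
    exact cfcₙ_mem (𝕜' := ℂ) (s := bAlg B hB) Real.sqrt he
  · rw [(IsSelfAdjoint.of_nonneg (CFC.sqrt_nonneg e)).star_eq]
    exact CFC.sqrt_mul_sqrt_self e

theorem eq_zero_of_star_mul {x : H →L[ℂ] H} (h : star x * x = 0) : x = 0 := by
  simpa using h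

/-- If `e = g* g` kills `z` then `g` kills `z`. -/
theorem g_kill {e g z : H →L[ℂ] H} (h : star g * g = e) (hz : e * z = 0) : g * z = 0 := by
  apply eq_zero_of_star_mul
  rw [star_mul, mul_assoc, ← mul_assoc (star g), h, hz, mul_zero]

theorem pos_kill {e p : H →L[ℂ] H} (h0 : 0 ≤ e) (hz : star p * e * p = 0) : e * p = 0 := by
  have hs : CFC.sqrt e * CFC.sqrt e = e := CFC.sqrt_mul_sqrt_self e
  have hss := (IsSelfAdjoint.of_nonneg (CFC.sqrt_nonneg e)).star_eq
  have : CFC.sqrt e * p = 0 := by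
    apply eq_zero_of_star_mul
    rw [star_mul, hss, mul_assoc, ← mul_assoc (CFC.sqrt e), hs, ← mul_assoc, hz]
  rw [← hs, mul_assoc, this, mul_zero]


theorem res_abs {A : Type*} [CStarAlgebra A] [PartialOrder A] [StarOrderedRing A] (h : A)
    (h0 : 0 ≤ h) (η : ℝ) (hηp : 0 < η) :
    star (cfc (fun t : ℝ => (t + η)⁻¹) h) = cfc (fun t : ℝ => (t + η)⁻¹) h ∧
    Commute h (cfc (fun t : ℝ => (t + η)⁻¹) h) ∧
    ‖h * ((1 - cfc (fun t : ℝ => (t + η)⁻¹) h * h) * (1 - cfc (fun t : ℝ => (t + η)⁻¹) h * h))‖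
      ≤ η := by
  have hsp : ∀ t ∈ spectrum ℝ h, 0 ≤ t := fun t ht => spectrum_nonneg_of_nonneg h0 ht
  have hc : ContinuousOn (fun t : ℝ => (t + η)⁻¹) (spectrum ℝ h) :=
    ContinuousOn.inv₀ (by fun_prop) (fun t ht => by have := hsp t ht; positivity)
  have hid : cfc (fun t : ℝ => t) h = h := cfc_id' ℝ h
  refine ⟨(cfc_predicate (p := IsSelfAdjoint) _ h).star_eq, ?_, ?_⟩
  · have := cfc_commute_cfc (fun t : ℝ => t) (fun t : ℝ => (t + η)⁻¹) h
    rwa [hid] at this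
  · have e1 : cfc (fun t : ℝ => 1 - (t + η)⁻¹ * t) h
        = 1 - cfc (fun t : ℝ => (t + η)⁻¹) h * h := by
      rw [cfc_sub (fun _ => (1:ℝ)) (fun t => (t + η)⁻¹ * t) h (by fun_prop) (by fun_prop),
        cfc_const_one ℝ h, cfc_mul (fun t : ℝ => (t + η)⁻¹) (fun t => t) h hc (by fun_prop), hid]
    have hc1 : ContinuousOn (fun t : ℝ => 1 - (t + η)⁻¹ * t) (spectrum ℝ h) := by fun_prop
    rw [← e1, ← cfc_mul _ _ h hc1 hc1]
    nth_rewrite 1 [← hid]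
    rw [← cfc_mul (fun t : ℝ => t) (fun t : ℝ => (1 - (t + η)⁻¹ * t) * (1 - (t + η)⁻¹ * t)) h
      (by fun_prop) (hc1.mul hc1)]
    refine norm_cfc_le hηp.le fun t ht => ?_
    have ht0 := hsp t ht
    have hp : 0 < t + η := by positivity
    have : 1 - (t + η)⁻¹ * t = η / (t + η) := by field_simp; ring
    rw [this, Real.norm_of_nonneg (by positivity), div_mul_div_comm, mul_div_assoc',
      div_le_iff₀ (by positivity)]
    nlinarith [mul_nonneg ht0 ht0, mul_nonneg hηp.le hηp.le, mul_pos hηp hηp,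
      mul_nonneg ht0 (mul_nonneg ht0 hηp.le), mul_nonneg ht0 (mul_nonneg hηp.le hηp.le),
      pow_pos hηp 3]

/-- Approximate factorization. -/
theorem approx_fact {B : Set (H →L[ℂ] H)} (hB : IsCStarSubalg B) {x : H →L[ℂ] H}
    (hx : x ∈ B) (ε : ℝ) (hε : 0 < ε) :
    ∃ z ∈ multiplierSet B, ‖x - x * z * star x * x‖ < ε := by
  have h0 : 0 ≤ star x * x := star_mul_self_nonneg x
  have hhB : star x * x ∈ B := hB.mul_mem (hB.star_mem hx) hx
  have hηp : 0 < ε ^ 2 / 2 := by positivity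
  obtain ⟨hzs, hcomm, hn⟩ := res_abs (star x * x) h0 (ε ^ 2 / 2) hηp
  refine ⟨cfc (fun t : ℝ => (t + ε ^ 2 / 2)⁻¹) (star x * x), cfc_mult hB _ hhB, ?_⟩
  generalize cfc (fun t : ℝ => (t + ε ^ 2 / 2)⁻¹) (star x * x) = z at *
  have hn' : ‖x - x * z * star x * x‖ * ‖x - x * z * star x * x‖ ≤ ε ^ 2 / 2 := by
    rw [← CStarRing.norm_star_mul_self]
    refine le_trans (le_of_eq ?_) hn
    congr 1
    have e3 : x - x * z * star x * x = x * (1 - z * (star x * x)) := by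
      noncomm_ring
    have e4 : star (x * (1 - z * (star x * x))) = (1 - z * (star x * x)) * star x := by
      rw [star_mul, star_sub, star_one, star_mul, hzs, star_mul, star_star, hcomm.eq]
    rw [e3, e4, mul_assoc, ← mul_assoc (star x)]
    have : Commute (star x * x) (1 - z * (star x * x)) :=
      (Commute.one_right _).sub_right (hcomm.mul_right (Commute.refl _))
    rw [← mul_assoc, ← this.eq, mul_assoc]
  by_contra hcon
  push Not at hcon
  have := le_trans (mul_le_mul hcon hcon hε.le (norm_nonneg _)) hn'
  nlinarith

/-- Left multiplication by `v` extends. -/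
theorem half_ext {B : Set (H →L[ℂ] H)} (hB : IsCStarSubalg B) {v p : H →L[ℂ] H}
    (hps : IsSelfAdjoint p) (hv : ∀ a ∈ her B p, v * a ∈ B)
    {y : H →L[ℂ] H} (hy : y ∈ B) (hpy : p * y = y) : v * y ∈ B := by
  have hyp : star y * p = star y := by
    have := congrArg star hpy; rwa [star_mul, hps.star_eq] at this
  have : v * y ∈ closure B := by
    rw [Metric.mem_closure_iff]
    intro ε hε
    obtain ⟨z, hz, hzn⟩ := approx_fact hB hy (ε / (‖v‖ + 1)) (by positivity)
    refine ⟨v * (y * z * star y) * y, ?_, ?_⟩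
    · refine hB.mul_mem (hv _ ⟨?_, ?_⟩) hy
      · exact hB.mul_mem (hz _ hy).2 (hB.star_mem hy)
      · rw [← mul_assoc, ← mul_assoc, hpy, mul_assoc, hyp]
    · rw [dist_eq_norm]
      have : v * y - v * (y * z * star y) * y = v * (y - y * z * star y * y) := by noncomm_ring
      rw [this]
      calc _ ≤ ‖v‖ * ‖y - y * z * star y * y‖ := norm_mul_le _ _
        _ ≤ ‖v‖ * (ε / (‖v‖ + 1)) := by gcongr
        _ < ε := by
          rw [mul_div_assoc', div_lt_iff₀ (by positivity)]
          nlinarith [norm_nonneg v]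
  rwa [hB.isClosed.closure_eq] at this

theorem proj_le_one {p : H →L[ℂ] H} (hp : IsProjectionOp p) : p ≤ 1 := by
  have : (1 : H →L[ℂ] H) - p = star (1 - p) * (1 - p) := by
    rw [star_sub, star_one, hp.1.star_eq, mul_sub, sub_mul, sub_mul, hp.2.eq]; simp
  rw [← sub_nonneg, this]; exact star_mul_self_nonneg _

theorem proj_nonneg {p : H →L[ℂ] H} (hp : IsProjectionOp p) : 0 ≤ p := by
  have : p = star p * p := by rw [hp.1.star_eq, hp.2.eq]
  rw [this]; exact star_mul_self_nonneg _

/-- a positive below a projection is supported on it. -/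
theorem mul_of_le_proj {a p : H →L[ℂ] H} (hp : IsProjectionOp p) (h0 : 0 ≤ a) (h : a ≤ p) :
    a * p = a := by
  have : star (1 - p) * a * (1 - p) ≤ star (1 - p) * p * (1 - p) :=
    star_left_conjugate_le_conjugate h _
  have e : star (1 - p) * p * (1 - p) = 0 := by
    rw [mul_assoc, mul_sub, mul_one, hp.2.eq, sub_self, mul_zero]
  rw [e] at this
  have := pos_kill h0 (le_antisymm this (star_left_conjugate_nonneg h0 _))
  rw [mul_sub, mul_one, sub_eq_zero] at this
  exact this.symm

theorem proj_le_of_mul {p q : H →L[ℂ] H} (hp : IsProjectionOp p) (hq : IsProjectionOp q)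
    (h : p * q = p) : p ≤ q := by
  have h' : q * p = p := by
    have := congrArg star h; rwa [star_mul, hp.1.star_eq, hq.1.star_eq] at this
  have hqp : IsProjectionOp (q - p) := by
    refine ⟨hq.1.sub hp.1, ?_⟩
    unfold IsIdempotentElem
    rw [mul_sub, sub_mul, sub_mul, h, h', hp.2.eq, hq.2.eq]; simp
  exact sub_nonneg.1 (proj_nonneg hqp)

/-- Elements of the net are below the limit. -/
theorem net_le {ι : Type*} (le : ι → ι → Prop) (a : ι → H →L[ℂ] H) (p : H →L[ℂ] H)
    (hp : IsSelfAdjoint p)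
    (hdir : ∀ i j, ∃ k, le i k ∧ le j k) (hpos : ∀ i, (a i).IsPositive)
    (hm : ∀ i j, le i j → opLE (a i) (a j))
    (hl : ∀ x : H, ∀ ε : ℝ, 0 < ε → ∃ i, ∀ j, le i j → ‖a j x - p x‖ < ε) (i : ι) :
    a i ≤ p := by
  rw [ContinuousLinearMap.le_def, ContinuousLinearMap.isPositive_iff_complex]
  have hsa : IsSelfAdjoint (p - a i) := hp.sub (hpos i).isSelfAdjoint
  intro x
  have hre := (ContinuousLinearMap.isSelfAdjoint_iff_isSymmetric.1 hsa).coe_reApplyInnerSelf_apply x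
  refine ⟨hre, ?_⟩
  by_contra hneg
  push Not at hneg
  change RCLike.re (inner ℂ ((p - a i) x) x) < 0 at hneg
  set r := RCLike.re (inner ℂ ((p - a i) x) x) with hr
  obtain ⟨i₀, hi₀⟩ := hl x (-r / (‖x‖ + 1)) (div_pos (by linarith) (by positivity))
  obtain ⟨k, hk1, hk2⟩ := hdir i i₀
  have h1 := hi₀ k hk2
  have h2 : 0 ≤ RCLike.re (inner ℂ ((a k - a i) x) x) := (hm i k hk1).re_inner_nonneg_left x
  have h3 : r = RCLike.re (inner ℂ ((a k - a i) x) x) - RCLike.re (inner ℂ (a k x - p x) x) := by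
    rw [hr, ← map_sub, ← inner_sub_left]; congr 2; simp
  have h4 : RCLike.re (inner ℂ (a k x - p x) x) ≤ ‖a k x - p x‖ * ‖x‖ := re_inner_le_norm _ _
  have h5 : ‖a k x - p x‖ * ‖x‖ ≤ (-r / (‖x‖ + 1)) * ‖x‖ := by gcongr
  have h6 : (-r / (‖x‖ + 1)) * ‖x‖ < -r := by
    rw [div_mul_eq_mul_div, div_lt_iff₀ (by positivity)]
    nlinarith [norm_nonneg x]
  linarith

theorem unit_abs {A : Type*} [CStarAlgebra A] [PartialOrder A] [StarOrderedRing A] (d : A)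
    (h0 : 0 ≤ d) :
    ∃ a z : ℕ → A, (∀ n, z n = cfc (fun t : ℝ => (t + 1 / ((n : ℝ) + 1))⁻¹) d) ∧
      (∀ n, a n = d * z n) ∧ (∀ n, a n = z n * d) ∧ (∀ n, 0 ≤ a n) ∧ (∀ n, ‖a n‖ ≤ 1) ∧
      (∀ i j, i ≤ j → a i ≤ a j) ∧ ∀ n, ‖a n * d - d‖ ≤ 1 / ((n : ℝ) + 1) := by
  have hsp : ∀ t ∈ spectrum ℝ d, 0 ≤ t := fun t ht => spectrum_nonneg_of_nonneg h0 ht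
  have hp : ∀ n : ℕ, 0 < 1 / ((n : ℝ) + 1) := fun n => by positivity
  have hc : ∀ n : ℕ, ContinuousOn (fun t : ℝ => (t + 1 / ((n : ℝ) + 1))⁻¹) (spectrum ℝ d) :=
    fun n => ContinuousOn.inv₀ (by fun_prop) (fun t ht => by
      have := hsp t ht; have := hp n; positivity)
  have hid : cfc (fun t : ℝ => t) d = d := cfc_id' ℝ d
  have ha1 : ∀ n : ℕ, cfc (fun t : ℝ => t * (t + 1 / ((n : ℝ) + 1))⁻¹) d
      = d * cfc (fun t : ℝ => (t + 1 / ((n : ℝ) + 1))⁻¹) d := fun n => by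
    rw [cfc_mul (fun t : ℝ => t) (fun t : ℝ => (t + 1 / ((n : ℝ) + 1))⁻¹) d (by fun_prop) (hc n),
      hid]
  have hct : ∀ n : ℕ, ContinuousOn (fun t : ℝ => t * (t + 1 / ((n : ℝ) + 1))⁻¹) (spectrum ℝ d) :=
    fun n => continuousOn_id.mul (hc n)
  refine ⟨fun n => cfc (fun t : ℝ => t * (t + 1 / ((n : ℝ) + 1))⁻¹) d,
    fun n => cfc (fun t : ℝ => (t + 1 / ((n : ℝ) + 1))⁻¹) d, fun n => rfl, ha1, ?_, ?_, ?_, ?_, ?_⟩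
  · intro n
    rw [← (res_abs d h0 _ (hp n)).2.1.eq]
    exact ha1 n
  · intro n
    refine cfc_nonneg fun t ht => ?_
    have := hsp t ht; have := hp n; positivity
  · intro n
    refine norm_cfc_le zero_le_one fun t ht => ?_
    have h1 := hsp t ht
    have h2 := hp n
    rw [Real.norm_of_nonneg (by positivity), ← div_eq_mul_inv, div_le_one (by positivity)]
    linarith
  · intro i j hij
    refine cfc_mono (fun t ht => ?_) (hct i) (hct j)
    have h1 := hsp t ht
    have := hp i
    have := hp j
    have h3 : 1 / ((j : ℝ) + 1) ≤ 1 / ((i : ℝ) + 1) := by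
      apply one_div_le_one_div_of_le (by positivity)
      have : (i : ℝ) ≤ j := by exact_mod_cast hij
      linarith
    gcongr
  · intro n
    have e : cfc (fun t : ℝ => t * (t + 1 / ((n : ℝ) + 1))⁻¹) d * d - d =
        cfc (fun t : ℝ => t * (t + 1 / ((n : ℝ) + 1))⁻¹ * t - t) d := by
      rw [cfc_sub (fun t : ℝ => t * (t + 1 / ((n : ℝ) + 1))⁻¹ * t) (fun t => t) d
        ((hct n).mul continuousOn_id) (by fun_prop),
        cfc_mul (fun t : ℝ => t * (t + 1 / ((n : ℝ) + 1))⁻¹) (fun t => t) d (hct n) (by fun_prop),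
        hid]
    rw [e]
    refine norm_cfc_le (hp n).le fun t ht => ?_
    have h1 := hsp t ht
    have h2 := hp n
    generalize 1 / ((n : ℝ) + 1) = η at *
    have : t * (t + η)⁻¹ * t - t = - (η * t / (t + η)) := by field_simp; ring
    rw [this, norm_neg, Real.norm_of_nonneg (by positivity), div_le_iff₀ (by positivity)]
    nlinarith

theorem starProj_isProj (U : Submodule ℂ H) [U.HasOrthogonalProjection] :
    IsProjectionOp U.starProjection :=
  ⟨isSelfAdjoint_starProjection U, U.isIdempotentElem_starProjection⟩

theorem open_support {B : Set (H →L[ℂ] H)} (hB : IsCStarSubalg B) {d : H →L[ℂ] H}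
    (hd : d ∈ B) (h0 : 0 ≤ d) :
    ∃ q, IsOpenProjection B q ∧ d * q = d ∧ ∀ T : H →L[ℂ] H, d * T = 0 → q * T = 0 := by
  have hdsa : IsSelfAdjoint d := IsSelfAdjoint.of_nonneg h0
  let U : Submodule ℂ H := (d.range).topologicalClosure
  have hU : ∀ x, d x ∈ U := fun x => Submodule.le_topologicalClosure _ (by simp)
  have hpr := starProj_isProj U
  have hqd : U.starProjection * d = d := by
    ext x
    exact (Submodule.starProjection_eq_self_iff).2 (hU x)
  have hdq : d * U.starProjection = d := by
    have := congrArg star hqd; rwa [star_mul, hpr.1.star_eq, hdsa.star_eq] at this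
  refine ⟨U.starProjection, ⟨hpr, ?_⟩, hdq, ?_⟩
  · obtain ⟨a, z, hz, ha1, ha2, ha0, han, ham, had⟩ := unit_abs d h0
    refine ⟨ℕ, (· ≤ ·), a, ⟨0⟩, fun _ => le_rfl, fun _ _ _ => le_trans,
      fun i j => ⟨max i j, le_max_left _ _, le_max_right _ _⟩, ?_, ?_, ?_, ?_⟩
    · intro n
      rw [ha1, hz]
      exact (cfc_mult hB _ hd d hd).2
    · intro n; exact (ContinuousLinearMap.nonneg_iff_isPositive _).1 (ha0 n)
    · intro i j hij; exact ham i j hij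
    · intro x ε hε
      have hx : U.starProjection x ∈ closure (Set.range d) := by
        have : U.starProjection x ∈ U := by simp
        rw [← SetLike.mem_coe, Submodule.topologicalClosure_coe] at this
        exact this
      obtain ⟨_, ⟨k, rfl⟩, hk⟩ := Metric.mem_closure_iff.1 hx (ε / 3) (by positivity)
      rw [dist_eq_norm] at hk
      obtain ⟨N, hN⟩ := exists_nat_gt (3 * ‖k‖ / ε)
      refine ⟨N, fun n hn => ?_⟩
      have hk2 : 1 / ((n : ℝ) + 1) * ‖k‖ < ε / 3 := by
        have h1 : (N : ℝ) ≤ n := by exact_mod_cast hn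
        rw [div_lt_iff₀ hε] at hN
        rw [one_div_mul_eq_div, div_lt_iff₀ (by positivity)]
        nlinarith
      have e1 : a n x = a n (U.starProjection x) := by
        rw [ha2]
        change z n (d x) = z n ((d * U.starProjection) x)
        rw [hdq]
      have e2 : a n x - U.starProjection x = a n (U.starProjection x - d k)
          + (a n * d - d) k - (U.starProjection x - d k) := by
        rw [e1]; simp
      have n1 : ‖a n (U.starProjection x - d k)‖ ≤ ‖U.starProjection x - d k‖ := by
        calc _ ≤ ‖a n‖ * ‖U.starProjection x - d k‖ := ContinuousLinearMap.le_opNorm _ _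
          _ ≤ 1 * _ := by gcongr; exact han n
          _ = _ := one_mul _
      have n2 : ‖(a n * d - d) k‖ ≤ 1 / ((n : ℝ) + 1) * ‖k‖ :=
        (ContinuousLinearMap.le_opNorm _ _).trans (by gcongr; exact had n)
      rw [e2]
      calc _ ≤ ‖a n (U.starProjection x - d k) + (a n * d - d) k‖ + ‖U.starProjection x - d k‖ :=
            norm_sub_le _ _
        _ ≤ ‖a n (U.starProjection x - d k)‖ + ‖(a n * d - d) k‖ + ‖U.starProjection x - d k‖ := by
            gcongr; exact norm_add_le _ _
        _ < ε := by linarith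
  · intro T hT
    have hTd : star T * d = 0 := by
      have := congrArg star hT; rwa [star_mul, hdsa.star_eq, star_zero] at this
    have hTU : ∀ u ∈ U, star T u = 0 := by
      intro u hu
      have hcl : IsClosed {u : H | star T u = 0} :=
        isClosed_eq (star T).continuous continuous_const
      have hsub : (d.range : Set H) ⊆ {u : H | star T u = 0} := by
        rintro _ ⟨k, rfl⟩
        change (star T * d) k = 0
        rw [hTd]; rfl
      have : (U : Set H) ⊆ {u : H | star T u = 0} := by
        simp only [U, Submodule.topologicalClosure_coe]
        exact closure_minimal hsub hcl
      exact this hu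
    have : star T * U.starProjection = 0 := by
      ext x; exact hTU _ (by simp)
    have := congrArg star this
    rwa [star_mul, hpr.1.star_eq, star_star, star_zero] at this

theorem exists_strict {B S : Set (H →L[ℂ] H)} (hB : IsCStarSubalg B)
    (hsep : TopologicalSpace.IsSeparable B) (hS : S ⊆ B) (hS0 : 0 ∈ S) (hpos : ∀ x ∈ S, 0 ≤ x) :
    ∃ d ∈ B, 0 ≤ d ∧ (∀ T : H →L[ℂ] H, (∀ x ∈ S, x * T = 0) → d * T = 0) ∧
      ∀ T : H →L[ℂ] H, d * T = 0 → ∀ x ∈ S, x * T = 0 := by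
  obtain ⟨t, htS, htc, hSt⟩ := (hsep.mono hS).exists_countable_dense_subset
  have hne : t.Nonempty := by
    rw [← closure_nonempty_iff]; exact ⟨0, hSt hS0⟩
  obtain ⟨x, rfl⟩ := htc.exists_eq_range hne
  have hxS : ∀ n, x n ∈ S := fun n => htS ⟨n, rfl⟩
  let c : ℕ → ℝ := fun n => (1 / 2) ^ n / (‖x n‖ + 1)
  have hc : ∀ n, 0 < c n := fun n => by positivity
  have hsum : Summable (fun n => c n • x n) := by
    refine Summable.of_norm_bounded (g := fun n => (1 / 2 : ℝ) ^ n) summable_geometric_two fun n => ?_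
    rw [norm_smul, Real.norm_of_nonneg (hc n).le, div_mul_eq_mul_div, div_le_iff₀ (by positivity)]
    nlinarith [norm_nonneg (x n), pow_pos (show (0:ℝ) < 1 / 2 by norm_num) n]
  have hxp : ∀ n, 0 ≤ c n • x n := fun n => smul_nonneg (hc n).le (hpos _ (hxS n))
  have hd0 : 0 ≤ ∑' n, c n • x n := tsum_nonneg hxp
  refine ⟨∑' n, c n • x n, ?_, hd0, ?_, ?_⟩
  · refine hB.isClosed.mem_of_tendsto hsum.hasSum.tendsto_sum_nat (Eventually.of_forall fun N => ?_)
    induction N with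
    | zero => simpa using hB.zero_mem
    | succ N ih =>
      rw [Finset.sum_range_succ]
      refine hB.add_mem ih ?_
      have := hB.smul_mem (c N : ℂ) (hS (hxS N))
      simpa using this
  · intro T hT
    rw [← hsum.tsum_mul_right]
    simp [hT _ (hxS _)]
  · intro T hT
    have hn : ∀ n, x n * T = 0 := by
      intro n
      have hle : c n • x n ≤ ∑' n, c n • x n := hsum.le_tsum n fun j _ => hxp j
      have h1 := star_left_conjugate_le_conjugate hle T
      rw [mul_assoc (star T) (∑' n, c n • x n), hT, mul_zero] at h1
      have := pos_kill (hxp n) (le_antisymm h1 (star_left_conjugate_nonneg (hxp n) T))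
      rw [smul_mul_assoc, smul_eq_zero] at this
      exact this.resolve_left (hc n).ne'
    intro y hy
    have hcl : IsClosed {y : H →L[ℂ] H | y * T = 0} :=
      isClosed_eq (continuous_id.mul continuous_const) continuous_const
    exact closure_minimal (by rintro _ ⟨n, rfl⟩; exact hn n) hcl (hSt hy)

theorem IsProjectionOp.compl {p : H →L[ℂ] H} (hp : IsProjectionOp p) : IsProjectionOp (1 - p) := by
  refine ⟨(IsSelfAdjoint.one _).sub hp.1, hp.2.one_sub⟩

/-- Criterion for compact containment. -/
theorem compact_of {B : Set (H →L[ℂ] H)} (hB : IsCStarSubalg B)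
    (hsep : TopologicalSpace.IsSeparable B) (hnd : Nondegenerate B) {p q a : H →L[ℂ] H}
    (hp : IsProjectionOp p) (ha : a ∈ her B q) (ha0 : 0 ≤ a) (ha1 : ‖a‖ ≤ 1) (hpa : p * a = p) :
    IsCompactlyContained B p q := by
  have hasa := IsSelfAdjoint.of_nonneg ha0
  have hap : a * p = p := by
    have := congrArg star hpa; rwa [star_mul, hp.1.star_eq, hasa.star_eq] at this
  obtain ⟨d, hdB, hd0, hdT, hdS⟩ := exists_strict (S := {x | x ∈ B ∧ 0 ≤ x ∧ x * p = 0}) hB hsep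
    (fun x hx => hx.1) ⟨hB.zero_mem, le_rfl, zero_mul _⟩ (fun x hx => hx.2.1)
  obtain ⟨e, heo, hde, heT⟩ := open_support hB hdB hd0
  have hep := heo.1
  have hSe : ∀ x, x ∈ B → 0 ≤ x → x * p = 0 → x * e = x := by
    intro x h1 h2 h3
    have := hdS (1 - e) (by rw [mul_sub, mul_one, hde, sub_self]) x ⟨h1, h2, h3⟩
    rw [mul_sub, mul_one, sub_eq_zero] at this; exact this.symm
  have hpe : e * p = 0 := heT p (hdT p fun x hx => hx.2.2)
  have hpe' : p * e = 0 := by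
    have := congrArg star hpe; rwa [star_mul, hp.1.star_eq, hep.1.star_eq, star_zero] at this
  refine ⟨1 - e, ⟨⟨hep.compl, by simpa using heo⟩, ?_, ?_⟩, a, ha,
    (ContinuousLinearMap.nonneg_iff_isPositive _).1 ha0, ha1, ?_⟩
  · exact proj_le_of_mul hp hep.compl (by rw [mul_sub, mul_one, hpe', sub_zero])
  · rintro q' ⟨hq', hq'o⟩ hpq
    have hpq' : p * q' = p := mul_of_le_proj hq' (proj_nonneg hp) hpq
    obtain ⟨-, ι, le, b, ⟨i₁⟩, hr, htr, hdir, hbB, hbp, hbm, hbl⟩ := hq'o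
    have hq'c := hq'.compl
    have hb0 : ∀ i, 0 ≤ b i := fun i => (ContinuousLinearMap.nonneg_iff_isPositive _).2 (hbp i)
    have hble : ∀ i, b i ≤ 1 - q' := net_le le b _ hq'c.1 hdir hbp hbm hbl
    have hbq : ∀ i, b i * (1 - q') = b i := fun i => mul_of_le_proj hq'c (hb0 i) (hble i)
    have hqp : q' * p = p := by
      have := congrArg star hpq'; rwa [star_mul, hp.1.star_eq, hq'.1.star_eq] at this
    have hbe : ∀ i, b i * e = b i := fun i => hSe _ (hbB i) (hb0 i) (by
      rw [← hbq i, mul_assoc, sub_mul, one_mul, hqp, sub_self, mul_zero])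
    have hz : (1 - q') * (1 - e) = 0 := by
      ext x
      by_contra hne
      have hpos : 0 < ‖(1 - q') ((1 - e) x)‖ := norm_pos_iff.2 hne
      obtain ⟨i, hi⟩ := hbl ((1 - e) x) _ hpos
      have h1 := hi i (hr i)
      have : b i ((1 - e) x) = 0 := by
        change (b i * (1 - e)) x = 0
        rw [mul_sub, mul_one, hbe, sub_self]; rfl
      rw [this, zero_sub, norm_neg] at h1
      exact lt_irrefl _ h1
    have hz' : (1 - e) * (1 - q') = 0 := by
      have := congrArg star hz
      rwa [star_mul, hq'c.1.star_eq, hep.compl.1.star_eq, star_zero] at this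
    refine proj_le_of_mul hep.compl hq' ?_
    rw [mul_sub, mul_one, sub_eq_zero] at hz'; exact hz'.symm
  · -- c * a = c
    have hb : ∀ b ∈ B, (1 - e) * ((1 - a) * b) = 0 := by
      intro b hb
      have haM := mem_mult hB ha.1
      have hyB : (1 - a) * b ∈ B := by
        rw [sub_mul, one_mul]; exact hB.sub_mem hb (haM b hb).1
      have hx := hSe (((1 - a) * b) * star ((1 - a) * b)) (hB.mul_mem hyB (hB.star_mem hyB))
        (mul_star_self_nonneg _) (by
          rw [star_mul, star_sub, star_one, hasa.star_eq, mul_assoc, mul_assoc (star b),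
            sub_mul 1 a p, one_mul, hap, sub_self, mul_zero, mul_zero])
      have h3 : star ((1 - a) * b) * (1 - e) = 0 := by
        refine g_kill (e := (1 - a) * b * star ((1 - a) * b)) (by rw [star_star]) ?_
        rw [mul_sub, mul_one, hx, sub_self]
      have := congrArg star h3
      rwa [star_mul, hep.compl.1.star_eq, star_star, star_zero] at this
    have hz : (1 - e) * (1 - a) = 0 := by
      ext x
      by_contra hne
      have hpos : 0 < ‖((1 - e) * (1 - a)) x‖ := norm_pos_iff.2 hne
      obtain ⟨b, hbB, hbx⟩ := hnd x (‖((1 - e) * (1 - a)) x‖ / (‖(1 - e) * (1 - a)‖ + 1))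
        (by positivity)
      have h0 : ((1 - e) * (1 - a)) (b x) = 0 := by
        have := hb b hbB
        rw [← mul_assoc] at this
        change ((1 - e) * (1 - a) * b) x = 0
        rw [this]; rfl
      have h1 : ‖((1 - e) * (1 - a)) (b x - x)‖ ≤ ‖(1 - e) * (1 - a)‖ * ‖b x - x‖ :=
        ContinuousLinearMap.le_opNorm _ _
      rw [map_sub, h0, zero_sub, norm_neg] at h1
      rw [lt_div_iff₀ (by positivity)] at hbx
      nlinarith [norm_nonneg (b x - x)]
    rw [mul_sub, mul_one, sub_eq_zero] at hz; exact hz.symm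

theorem compact_elim {B : Set (H →L[ℂ] H)} {p q : H →L[ℂ] H}
    (hp : IsProjectionOp p) (h : IsCompactlyContained B p q) :
    ∃ a ∈ her B q, 0 ≤ a ∧ ‖a‖ ≤ 1 ∧ p * a = p := by
  obtain ⟨c, ⟨hc, hpc, -⟩, a, ha, ha0, ha1, hca⟩ := h
  refine ⟨a, ha, (ContinuousLinearMap.nonneg_iff_isPositive _).2 ha0, ha1, ?_⟩
  have : p * c = p := mul_of_le_proj hc.1 (proj_nonneg hp) hpc
  rw [← this, mul_assoc, hca]

theorem iso_mul {v p : H →L[ℂ] H} (hp : IsProjectionOp p) (h : star v * v = p) : v * p = v := by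
  have : v * (1 - p) = 0 := by
    apply eq_zero_of_star_mul
    rw [star_mul, mul_assoc, ← mul_assoc (star v), h, mul_sub, mul_one, hp.2.eq, sub_self, mul_zero]
  rw [mul_sub, mul_one, sub_eq_zero] at this; exact this.symm

theorem left_of_right {a p : H →L[ℂ] H} (ha : IsSelfAdjoint a) (hp : IsSelfAdjoint p)
    (h : a * p = a) : p * a = a := by
  have := congrArg star h; rwa [star_mul, ha.star_eq, hp.star_eq] at this

theorem sot_mem {B : Set (H →L[ℂ] H)} {v p : H →L[ℂ] H} (hp : IsOpenProjection B p)
    (hvp : v * p = v) (hv : ∀ a ∈ her B p, v * a ∈ B) : v ∈ sotClosure B := by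
  obtain ⟨hpp, ι, le, a, ⟨i₁⟩, hr, htr, hdir, haB, hapos, ham, hal⟩ := hp
  have ha0 : ∀ i, 0 ≤ a i := fun i => (ContinuousLinearMap.nonneg_iff_isPositive _).2 (hapos i)
  have hap : ∀ i, a i * p = a i := fun i =>
    mul_of_le_proj hpp (ha0 i) (net_le le a p hpp.1 hdir hapos ham hal i)
  have hpa : ∀ i, p * a i = a i := fun i =>
    left_of_right (IsSelfAdjoint.of_nonneg (ha0 i)) hpp.1 (hap i)
  intro ε hε F
  have hδ : 0 < ε / (‖v‖ + 1) := by positivity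
  have key : ∃ i, ∀ j, le i j → ∀ x ∈ F, ‖a j x - p x‖ < ε / (‖v‖ + 1) := by
    classical
    induction F using Finset.induction_on with
    | empty => exact ⟨i₁, by simp⟩
    | insert x F _ ih =>
      obtain ⟨i, hi⟩ := ih
      obtain ⟨i', hi'⟩ := hal x _ hδ
      obtain ⟨k, hk, hk'⟩ := hdir i i'
      refine ⟨k, fun j hj y hy => ?_⟩
      rcases Finset.mem_insert.1 hy with rfl | hy
      · exact hi' j (htr _ _ _ hk' hj)
      · exact hi j (htr _ _ _ hk hj) y hy
  obtain ⟨i, hi⟩ := key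
  refine ⟨v * a i, hv _ ⟨haB i, by rw [hpa, hap]⟩, fun x hx => ?_⟩
  have h1 := hi i (hr i) x hx
  have e : v x - (v * a i) x = v (p x - a i x) := by
    rw [map_sub]; congr 1
    change v x = (v * p) x
    rw [hvp]
  rw [e]
  calc _ ≤ ‖v‖ * ‖p x - a i x‖ := ContinuousLinearMap.le_opNorm _ _
    _ ≤ ‖v‖ * (ε / (‖v‖ + 1)) := by rw [norm_sub_rev]; gcongr
    _ < ε := by
      rw [mul_div_assoc', div_lt_iff₀ (by positivity)]
      nlinarith [norm_nonneg v]

theorem pz_of_y {B : Set (H →L[ℂ] H)} (hB : IsCStarSubalg B) {s y : H →L[ℂ] H}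
    (hs : IsOpenProjection B s) (hy : y ∈ B) (hys : star y * y * s = s) :
    IsOpenProjection B (y * s * star y) ∧ PZEquiv B s (y * s * star y) := by
  have hsp := hs.1
  have hss : star (y * s) * (y * s) = s := by
    rw [star_mul, hsp.1.star_eq, mul_assoc, ← mul_assoc (star y), hys, hsp.2.eq]
  have hqs : star (y * s * star y) = y * s * star y := by
    rw [star_mul, star_mul, star_star, hsp.1.star_eq, mul_assoc]
  have hqq : (y * s * star y) * (y * s * star y) = y * s * star y := by
    have : (y * s * star y) * (y * s * star y) = y * s * (star y * y * s) * star y := by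
      noncomm_ring
    rw [this, hys, mul_assoc y, hsp.2.eq]
  have hvv : y * s * star (y * s) = y * s * star y := by
    rw [star_mul, hsp.1.star_eq, ← mul_assoc, mul_assoc y, hsp.2.eq]
  have hvB : ∀ a ∈ her B s, y * s * a ∈ B := by
    rintro a ⟨ha, hsa⟩
    have : s * a = a := by rw [← hsa, ← mul_assoc, ← mul_assoc, hsp.2.eq]
    rw [mul_assoc, this]; exact hB.mul_mem hy ha
  refine ⟨⟨⟨hqs, hqq⟩, ?_⟩, y * s, sot_mem hs (by rw [mul_assoc, hsp.2.eq]) hvB, hss, hvv, hvB, ?_⟩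
  · obtain ⟨hpp, ι, le, a, hne, hr, htr, hdir, haB, hapos, ham, hal⟩ := hs
    refine ⟨ι, le, fun i => y * a i * star y, hne, hr, htr, hdir, ?_, ?_, ?_, ?_⟩
    · intro i; exact hB.mul_mem (hB.mul_mem hy (haB i)) (hB.star_mem hy)
    · intro i
      rw [← ContinuousLinearMap.nonneg_iff_isPositive]
      exact star_right_conjugate_nonneg ((ContinuousLinearMap.nonneg_iff_isPositive _).2 (hapos i)) y
    · intro i j hij
      exact star_right_conjugate_le_conjugate (show a i ≤ a j from ham i j hij) y
    · intro x ε hε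
      obtain ⟨i, hi⟩ := hal (star y x) (ε / (‖y‖ + 1)) (by positivity)
      refine ⟨i, fun j hj => ?_⟩
      have e : (y * a j * star y) x - (y * s * star y) x = y (a j (star y x) - s (star y x)) := by
        rw [map_sub]; rfl
      rw [e]
      calc _ ≤ ‖y‖ * ‖a j (star y x) - s (star y x)‖ := ContinuousLinearMap.le_opNorm _ _
        _ ≤ ‖y‖ * (ε / (‖y‖ + 1)) := by gcongr; exact (hi j hj).le
        _ < ε := by
          rw [mul_div_assoc', div_lt_iff₀ (by positivity)]
          nlinarith [norm_nonneg y]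
  · rintro b ⟨hb, hqb⟩
    have h1 : y * s * star y * b = b := by
      calc y * s * star y * b = (y * s * star y) * ((y * s * star y) * b * (y * s * star y)) := by rw [hqb]
        _ = ((y * s * star y) * (y * s * star y)) * b * (y * s * star y) := by noncomm_ring
        _ = b := by rw [hqq, hqb]
    have h2 : star (y * s) * b = star y * b := by
      calc star (y * s) * b = s * star y * b := by rw [star_mul, hsp.1.star_eq]
        _ = (star y * y * s) * star y * b := by rw [hys]
        _ = star y * (y * s * star y * b) := by noncomm_ring
        _ = star y * b := by rw [h1]
    rw [h2]; exact hB.mul_mem (hB.star_mem hy) hb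

theorem half_comp {B : Set (H →L[ℂ] H)} (hB : IsCStarSubalg B) {v w p q : H →L[ℂ] H}
    (hq : IsProjectionOp q) (hvq : q * v = v)
    (hv : ∀ a ∈ her B p, v * a ∈ B) (hw : ∀ a ∈ her B q, w * a ∈ B) :
    ∀ a ∈ her B p, w * v * a ∈ B := by
  intro a ha
  rw [mul_assoc]
  exact half_ext hB hq.1 hw (hv a ha) (by rw [← mul_assoc, hvq])

theorem pz_trans {B : Set (H →L[ℂ] H)} (hB : IsCStarSubalg B) {p q r : H →L[ℂ] H}
    (hp : IsOpenProjection B p) (hq : IsProjectionOp q)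
    (h1 : PZEquiv B p q) (h2 : PZEquiv B q r) : PZEquiv B p r := by
  obtain ⟨v, -, hv1, hv2, hv3, hv4⟩ := h1
  obtain ⟨w, -, hw1, hw2, hw3, hw4⟩ := h2
  have hvp : v * p = v := iso_mul hp.1 hv1
  have hwq : w * q = w := iso_mul hq hw1
  have hvq : star v * q = star v := iso_mul (v := star v) hq (by rw [star_star, hv2])
  have hqv : q * v = v := by
    have := congrArg star hvq; rwa [star_mul, star_star, hq.1.star_eq] at this
  have hqw : q * star w = star w := by
    have := congrArg star hwq; rwa [star_mul, hq.1.star_eq] at this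
  have hA := half_comp hB hq hqv hv3 hw3
  refine ⟨w * v, sot_mem hp (by rw [mul_assoc, hvp]) hA, ?_, ?_, hA, ?_⟩
  · rw [star_mul, mul_assoc, ← mul_assoc (star w), hw1, hqv, hv1]
  · rw [star_mul, mul_assoc, ← mul_assoc v, hv2, hqw, hw2]
  · rw [star_mul]
    exact half_comp hB hq hqw hw4 hv4

theorem polar_abs {A : Type*} [CStarAlgebra A] [PartialOrder A] [StarOrderedRing A] (x f : A)
    (hf : star f = f) (hle : f * f ≤ (2 : ℝ) • (star x * x)) :
    ∃ W : ℕ → A, (∀ n : ℕ, W n = cfc (fun t : ℝ => (√(t + 1 / ((n : ℝ) + 1)))⁻¹) (star x * x)) ∧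
      CauchySeq (fun n => x * W n * f) ∧
      Tendsto (fun n => star (x * W n * f) * (x * W n * f)) atTop (𝓝 (f * f)) := by
  set h := star x * x with hh
  have h0 : 0 ≤ h := star_mul_self_nonneg x
  have hsp : ∀ t ∈ spectrum ℝ h, 0 ≤ t := fun t ht => spectrum_nonneg_of_nonneg h0 ht
  have hp : ∀ n : ℕ, 0 < 1 / ((n : ℝ) + 1) := fun n => by positivity
  have hcont : ∀ n : ℕ, ContinuousOn (fun t : ℝ => (√(t + 1 / ((n : ℝ) + 1)))⁻¹) (spectrum ℝ h) := by
    intro n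
    refine ContinuousOn.inv₀ (by fun_prop) fun t ht => ?_
    have := hsp t ht
    have := hp n
    positivity
  have hsq : ∀ n : ℕ, ∀ t ∈ spectrum ℝ h,
      (√(t + 1 / ((n : ℝ) + 1)))⁻¹ * (√(t + 1 / ((n : ℝ) + 1)))⁻¹ * (t + 1 / ((n : ℝ) + 1)) = 1 := by
    intro n t ht
    have h1 := hsp t ht
    have h2 := hp n
    have h3 : 0 < t + 1 / ((n : ℝ) + 1) := by linarith
    rw [← mul_inv, Real.mul_self_sqrt h3.le, inv_mul_cancel₀ h3.ne']
  have hid : cfc (fun t : ℝ => t) h = h := cfc_id' ℝ h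
  let W : ℕ → A := fun n => cfc (fun t : ℝ => (√(t + 1 / ((n : ℝ) + 1)))⁻¹) h
  have hWs : ∀ n, star (W n) = W n := fun n =>
    (cfc_predicate (fun t : ℝ => (√(t + 1 / ((n : ℝ) + 1)))⁻¹) h : IsSelfAdjoint _).star_eq
  have hWhW : ∀ n, W n * h * W n = 1 - (1 / ((n : ℝ) + 1)) • (W n * W n) := by
    intro n
    have e1 : W n * h * W n = cfc (fun t : ℝ => (√(t + 1 / ((n : ℝ) + 1)))⁻¹ * t *
        (√(t + 1 / ((n : ℝ) + 1)))⁻¹) h := by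
      rw [cfc_mul _ _ h ((hcont n).fun_mul (continuousOn_id' _)) (hcont n), cfc_mul _ _ h (hcont n) (continuousOn_id' _), hid]
    have e2 : (1 / ((n : ℝ) + 1)) • (W n * W n) = cfc (fun t : ℝ => (1 / ((n : ℝ) + 1)) • ((√(t + 1 / ((n : ℝ) + 1)))⁻¹ *
        (√(t + 1 / ((n : ℝ) + 1)))⁻¹)) h := by
      rw [cfc_smul _ _ h ((hcont n).fun_mul (hcont n)), cfc_mul _ _ h (hcont n) (hcont n)]
    rw [e1, e2, ← cfc_const_one ℝ h, ← cfc_sub _ _ h continuousOn_const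
      (((hcont n).fun_mul (hcont n)).fun_const_smul _)]
    refine cfc_congr fun t ht => ?_
    have := hsq n t ht
    simp only [smul_eq_mul]
    linarith
  have hWW0 : ∀ n, 0 ≤ W n * W n := fun n => by
    have := star_mul_self_nonneg (W n); rwa [hWs] at this
  have hWh1 : ∀ n, W n * h * W n ≤ 1 := by
    intro n
    rw [hWhW, sub_le_self_iff]
    exact smul_nonneg (hp n).le (hWW0 n)
  have hfW : ∀ n, ‖f * (W n * W n) * f‖ ≤ 2 := by
    intro n
    have h1 : W n * (f * f) * W n ≤ (2 : ℝ) • (1 : A) := by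
      have a1 := star_left_conjugate_le_conjugate hle (W n)
      rw [hWs] at a1
      refine a1.trans ?_
      rw [mul_smul_comm, smul_mul_assoc]
      exact smul_le_smul_of_nonneg_left (hWh1 n) (by norm_num)
    have h2 : ‖star (f * W n) * (f * W n)‖ ≤ 2 := by
      have e : star (f * W n) * (f * W n) = W n * (f * f) * W n := by
        rw [star_mul, hWs, hf]; noncomm_ring
      have h3 : 0 ≤ W n * (f * f) * W n := by rw [← e]; exact star_mul_self_nonneg _
      rw [e, CStarAlgebra.norm_le_iff_le_algebraMap _ (by norm_num) h3, Algebra.algebraMap_eq_smul_one]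
      exact h1
    have e : f * (W n * W n) * f = f * W n * star (f * W n) := by
      rw [star_mul, hWs, hf]; noncomm_ring
    rw [e, CStarRing.norm_self_mul_star]
    rwa [CStarRing.norm_star_mul_self] at h2
  have hD : ∀ m n, n ≤ m → (W m - W n) * h * (W m - W n) ≤ (1 / ((n : ℝ) + 1)) • (W n * W n) := by
    intro m n hnm
    have hc := (hcont m).fun_sub (hcont n)
    have e1 : (W m - W n) * h * (W m - W n) = cfc (fun t : ℝ =>
        ((√(t + 1 / ((m : ℝ) + 1)))⁻¹ - (√(t + 1 / ((n : ℝ) + 1)))⁻¹) * t *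
        ((√(t + 1 / ((m : ℝ) + 1)))⁻¹ - (√(t + 1 / ((n : ℝ) + 1)))⁻¹)) h := by
      rw [cfc_mul _ _ h (hc.fun_mul (continuousOn_id' _)) hc, cfc_mul _ _ h hc (continuousOn_id' _), hid,
        cfc_sub _ _ h (hcont m) (hcont n)]
    have e2 : (1 / ((n : ℝ) + 1)) • (W n * W n) = cfc (fun t : ℝ => (1 / ((n : ℝ) + 1)) • ((√(t + 1 / ((n : ℝ) + 1)))⁻¹ *
        (√(t + 1 / ((n : ℝ) + 1)))⁻¹)) h := by
      rw [cfc_smul _ _ h ((hcont n).fun_mul (hcont n)), cfc_mul _ _ h (hcont n) (hcont n)]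
    rw [e1, e2]
    refine cfc_mono (fun t ht => ?_) ((hc.fun_mul (continuousOn_id' _)).fun_mul hc) (((hcont n).fun_mul (hcont n)).fun_const_smul _)
    have s1 := hsq n t ht
    have s2 := hsq m t ht
    have t0 := hsp t ht
    have hmn : 1 / ((m : ℝ) + 1) ≤ 1 / ((n : ℝ) + 1) := by gcongr
    have hpm := hp m
    have hpn := hp n
    have hw : (√(t + 1 / ((n : ℝ) + 1)))⁻¹ ≤ (√(t + 1 / ((m : ℝ) + 1)))⁻¹ := by gcongr
    have hw0 : 0 ≤ (√(t + 1 / ((n : ℝ) + 1)))⁻¹ := by positivity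
    simp only [smul_eq_mul]
    generalize (√(t + 1 / ((n : ℝ) + 1)))⁻¹ = u at *
    generalize (√(t + 1 / ((m : ℝ) + 1)))⁻¹ = w at *
    generalize 1 / ((n : ℝ) + 1) = b at *
    generalize 1 / ((m : ℝ) + 1) = c at *
    have k1 : 0 ≤ t * (u * (w - u)) := mul_nonneg t0 (mul_nonneg hw0 (by linarith))
    have k2 : 0 ≤ c * (w * w) := mul_nonneg hpm.le (mul_self_nonneg w)
    nlinarith
  have hlim : Tendsto (fun n : ℕ => 1 / ((n : ℝ) + 1) * 2) atTop (𝓝 0) := by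
    simpa using tendsto_one_div_add_atTop_nhds_zero_nat.mul_const (2 : ℝ)
  refine ⟨W, fun n => rfl, ?_, ?_⟩
  · have key : ∀ m n, n ≤ m → ‖x * W m * f - x * W n * f‖ ≤ √(1 / ((n : ℝ) + 1) * 2) := by
      intro m n hnm
      apply Real.le_sqrt_of_sq_le
      rw [sq, ← CStarRing.norm_star_mul_self]
      have e : star (x * W m * f - x * W n * f) * (x * W m * f - x * W n * f) =
          star f * ((W m - W n) * h * (W m - W n)) * f := by
        simp only [star_sub, star_mul, hWs, hf, hh]; noncomm_ring
      have l := star_left_conjugate_le_conjugate (hD m n hnm) f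
      have z := star_mul_self_nonneg (x * W m * f - x * W n * f)
      rw [← e] at l
      refine (CStarAlgebra.norm_le_norm_of_nonneg_of_le z l).trans ?_
      rw [mul_smul_comm, smul_mul_assoc, norm_smul, hf, Real.norm_of_nonneg (hp n).le]
      exact mul_le_mul_of_nonneg_left (hfW n) (hp n).le
    refine cauchySeq_of_le_tendsto_0' (fun n : ℕ => √(1 / ((n : ℝ) + 1) * 2)) ?_ ?_
    · intro n m hnm
      rw [dist_comm, dist_eq_norm]; exact key m n hnm
    · have := (Real.continuous_sqrt.tendsto 0).comp hlim
      rw [Real.sqrt_zero] at this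
      exact this
  · rw [tendsto_iff_norm_sub_tendsto_zero]
    refine squeeze_zero (fun _ => norm_nonneg _) (fun n => ?_) hlim
    have e : star (x * W n * f) * (x * W n * f) - f * f =
        -((1 / ((n : ℝ) + 1)) • (f * (W n * W n) * f)) := by
      have : star (x * W n * f) * (x * W n * f) = f * (W n * h * W n) * f := by
        simp only [star_mul, hWs, hf, hh]; noncomm_ring
      rw [this, hWhW, mul_sub, sub_mul, mul_one, mul_smul_comm, smul_mul_assoc]; abel
    rw [e, norm_neg, norm_smul, Real.norm_of_nonneg (hp n).le]
    exact mul_le_mul_of_nonneg_left (hfW n) (hp n).le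

theorem polar {B : Set (H →L[ℂ] H)} (hB : IsCStarSubalg B) {x f : H →L[ℂ] H}
    (hx : x ∈ B) (hfB : f ∈ B)
    (hf : star f = f) (hle : f * f ≤ (2 : ℝ) • (star x * x)) :
    ∃ y ∈ B, star y * y = f * f ∧ ∀ a, a * x = x → a * y = y := by
  obtain ⟨W, hW, hc, ht⟩ := polar_abs x f hf hle
  obtain ⟨y, hy⟩ := cauchySeq_tendsto_of_complete hc
  refine ⟨y, ?_, ?_, ?_⟩
  · refine hB.isClosed.mem_of_tendsto hy (Eventually.of_forall fun n => ?_)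
    have : W n ∈ multiplierSet B := by
      rw [hW]; exact cfc_mult hB _ (hB.mul_mem (hB.star_mem hx) hx)
    exact hB.mul_mem (this x hx).2 hfB
  · exact tendsto_nhds_unique (hy.star.mul hy) ht
  · intro a ha
    refine tendsto_nhds_unique (hy.const_mul a) ?_
    simpa only [← mul_assoc, ha] using hy

theorem cutoff_abs {A : Type*} [CStarAlgebra A] [PartialOrder A] [StarOrderedRing A] (a : A)
    (h0 : 0 ≤ a) (c : A) (hc : ‖(1 - c) * a‖ ≤ 1 / 8) (h1 : ‖a‖ ≤ 1) (hcs : star c = c) :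
    ∃ G φ : A, G = cfc (fun t : ℝ => (max (1 - t) (1 / 2))⁻¹) a ∧ φ = 1 - (1 - a) * G ∧
      φ = 1 - G * (1 - a) ∧ star φ = φ ∧ a * φ = φ * a ∧
      (a * φ) * (a * φ) ≤ (2 : ℝ) • (a * φ * c * (a * φ)) := by
  have hsa : IsSelfAdjoint a := IsSelfAdjoint.of_nonneg h0
  have hcont : ContinuousOn (fun t : ℝ => (max (1 - t) (1 / 2))⁻¹) (spectrum ℝ a) := by
    refine ContinuousOn.inv₀ (by fun_prop) fun t ht => ?_
    positivity
  set G := cfc (fun t : ℝ => (max (1 - t) (1 / 2))⁻¹) a with hG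
  have hGs : star G = G := (cfc_predicate (fun t : ℝ => (max (1 - t) (1 / 2))⁻¹) a : IsSelfAdjoint _).star_eq
  have hcm : Commute a G := (cfc_commute_cfc (fun t : ℝ => t) (fun t : ℝ => (max (1 - t) (1 / 2))⁻¹) a |> fun h => by
    rwa [cfc_id' ℝ a] at h)
  have hcm1 : (1 - a) * G = G * (1 - a) := by rw [sub_mul, mul_sub, one_mul, mul_one, hcm.eq]
  set φ := 1 - (1 - a) * G with hφ
  have hφs : star φ = φ := by
    rw [hφ, star_sub, star_mul, hGs, star_sub, star_one, hsa.star_eq, hcm1]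
  have haφ : a * φ = φ * a := by
    have hca : Commute a φ :=
      (Commute.one_right a).sub_right (((Commute.one_right a).sub_right (Commute.refl a)).mul_right hcm)
    exact hca.eq
  have hφc : φ = cfc (fun t : ℝ => 1 - (1 - t) * (max (1 - t) (1 / 2))⁻¹) a := by
    rw [cfc_sub _ _ a continuousOn_const ((by fun_prop : ContinuousOn (fun t : ℝ => 1 - t) _).fun_mul hcont),
      cfc_mul _ _ a (by fun_prop) hcont, cfc_sub _ _ a (by fun_prop) (by fun_prop), cfc_const_one ℝ a,
      cfc_id' ℝ a]
  have hcφ : ContinuousOn (fun t : ℝ => 1 - (1 - t) * (max (1 - t) (1 / 2))⁻¹) (spectrum ℝ a) :=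
    continuousOn_const.fun_sub ((by fun_prop : ContinuousOn (fun t : ℝ => 1 - t) _).fun_mul hcont)
  have hmono : φ * φ ≤ (4 : ℝ) • ((a * φ) * (a * φ)) := by
    have e : (4 : ℝ) • ((a * φ) * (a * φ)) = cfc (fun t : ℝ => (4 : ℝ) •
        ((t * (1 - (1 - t) * (max (1 - t) (1 / 2))⁻¹)) * (t * (1 - (1 - t) * (max (1 - t) (1 / 2))⁻¹)))) a := by
      rw [cfc_smul _ _ a (((continuousOn_id' _).fun_mul hcφ).fun_mul ((continuousOn_id' _).fun_mul hcφ)),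
        cfc_mul _ _ a ((continuousOn_id' _).fun_mul hcφ) ((continuousOn_id' _).fun_mul hcφ),
        cfc_mul _ _ a (continuousOn_id' _) hcφ, ← hφc, cfc_id' ℝ a]
    have e' : φ * φ = cfc (fun t : ℝ => (1 - (1 - t) * (max (1 - t) (1 / 2))⁻¹) * (1 - (1 - t) * (max (1 - t) (1 / 2))⁻¹)) a := by
      rw [cfc_mul _ _ a hcφ hcφ, ← hφc]
    rw [e, e']
    refine cfc_mono (fun t ht => ?_) (hcφ.fun_mul hcφ)
      ((((continuousOn_id' _).fun_mul hcφ).fun_mul ((continuousOn_id' _).fun_mul hcφ)).fun_const_smul _)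
    simp only [smul_eq_mul]
    rcases le_total t (1 / 2) with h | h
    · rw [max_eq_left (by linarith), mul_inv_cancel₀ (by linarith : (1 - t) ≠ 0)]; simp
    · generalize (1 - (1 - t) * (max (1 - t) (1 / 2))⁻¹) = u
      have : 1 ≤ 4 * (t * t) := by nlinarith
      nlinarith [mul_self_nonneg u]
  have hac : a * (1 - c) * a ≤ (1 / 8 : ℝ) • (1 : A) := by
    have hs : IsSelfAdjoint (a * (1 - c) * a) := by
      rw [IsSelfAdjoint, star_mul, star_mul, hsa.star_eq, star_sub, star_one, hcs, mul_assoc]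
    have hn : ‖a * (1 - c) * a‖ ≤ 1 / 8 := by
      rw [mul_assoc]
      calc _ ≤ ‖a‖ * ‖(1 - c) * a‖ := norm_mul_le _ _
        _ ≤ 1 * (1 / 8) := by gcongr
        _ = _ := by norm_num
    calc _ ≤ algebraMap ℝ A ‖a * (1 - c) * a‖ := hs.le_algebraMap_norm_self
      _ ≤ algebraMap ℝ A (1 / 8) := by gcongr
      _ = _ := by rw [Algebra.algebraMap_eq_smul_one]
  refine ⟨G, φ, rfl, rfl, by rw [hφ, hcm1], hφs, haφ, ?_⟩
  have k := star_left_conjugate_le_conjugate hac φ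
  have e1 : star φ * (a * (1 - c) * a) * φ = (a * φ) * (a * φ) - a * φ * c * (a * φ) := by
    rw [hφs]
    calc _ = (φ * a) * (1 - c) * (a * φ) := by noncomm_ring
      _ = _ := by rw [← haφ, mul_sub, mul_one, sub_mul]
  have e2 : star φ * ((1 / 8 : ℝ) • (1 : A)) * φ = (1 / 8 : ℝ) • (φ * φ) := by
    rw [hφs, mul_smul_comm, mul_one, smul_mul_assoc]
  rw [e1, e2] at k
  have k2 := k.trans (smul_le_smul_of_nonneg_left hmono (by norm_num : (0 : ℝ) ≤ 1 / 8))
  rw [smul_smul] at k2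
  generalize (a * φ) * (a * φ) = X at *
  generalize a * φ * c * (a * φ) = Y at *
  have k3 := smul_le_smul_of_nonneg_left k2 (by norm_num : (0 : ℝ) ≤ 2)
  rw [smul_smul, show (2 : ℝ) * (1 / 8 * 4) = 1 by norm_num, one_smul, smul_sub, two_smul, sub_le_iff_le_add] at k3
  exact le_of_add_le_add_left k3

theorem tower {B : Set (H →L[ℂ] H)} (hB : IsCStarSubalg B) {p v a t : ℕ → H →L[ℂ] H}
    (hp : ∀ n, IsProjectionOp (p n)) (hv : ∀ n, star (v n) * v n = p n)
    (hvB : ∀ n, ∀ b ∈ her B (p n), v n * b ∈ B)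
    (ha : ∀ n, a n ∈ her B (p n)) (ha00 : a 0 = 0) (ha0 : ∀ n, 0 ≤ a n) (ha1 : ∀ n, ‖a n‖ ≤ 1)
    (hav : ∀ n, a (n + 1) * v n = v n) (htB : ∀ n, t n ∈ multiplierSet B)
    (ht1 : ∀ n, star (t n) * t n = 1) (ht0 : ∀ m n, m ≠ n → star (t m) * t n = 0) :
    ∃ V : ℕ → H →L[ℂ] H, (∀ n, star (V n) * V n = p n) ∧ (∀ n, V (n + 1) * v n = V n) ∧
      (∀ n, ∀ b ∈ her B (p n), V n * b ∈ B) ∧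
      ∀ k m, k < m → star (t k) * V (m + 1) = star (t k) * V m * star (v m) := by
  have hasa : ∀ n, star (a n) = a n := fun n => (IsSelfAdjoint.of_nonneg (ha0 n)).star_eq
  have hpa : ∀ n, p n * a n = a n := fun n => by
    calc p n * a n = p n * (p n * a n * p n) := by rw [(ha n).2]
      _ = (p n * p n) * a n * p n := by noncomm_ring
      _ = a n := by rw [(hp n).2.eq, (ha n).2]
  have hap : ∀ n, a n * p n = a n := fun n => by
    have := congrArg star (hpa n); rwa [star_mul, hasa, (hp n).1.star_eq] at this
  have hvp : ∀ n, v n * p n = v n := fun n => iso_mul (hp n) (hv n)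
  have hpv : ∀ n, p (n + 1) * v n = v n := fun n => by
    calc p (n + 1) * v n = (p (n + 1) * a (n + 1)) * v n := by rw [mul_assoc, hav]
      _ = v n := by rw [hpa, hav]
  have hvsa : ∀ n, star (v n) * a (n + 1) = star (v n) := fun n => by
    have := congrArg star (hav n); rwa [star_mul, hasa] at this
  have hvsp : ∀ n, star (v n) * p (n + 1) = star (v n) := fun n => by
    have := congrArg star (hpv n); rwa [star_mul, (hp _).1.star_eq] at this
  let e : ℕ → H →L[ℂ] H := fun n => a (n + 1) - v n * a n * star (v n)
  have heB : ∀ n, e n ∈ B := by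
    intro n
    refine hB.sub_mem (ha _).1 ?_
    have h1 : star (v n * a n) ∈ B := hB.star_mem (hvB n _ (ha n))
    rw [star_mul, hasa] at h1
    rw [mul_assoc]
    exact half_ext hB (hp n).1 (hvB n) h1 (by rw [← mul_assoc, hpa])
  have he0 : ∀ n, 0 ≤ e n := by
    intro n
    have h1 : a n ≤ 1 := (CStarAlgebra.norm_le_one_iff_of_nonneg (a n) (ha0 n)).1 (ha1 n)
    have h2 : v n * a n * star (v n) ≤ v n * 1 * star (v n) := star_right_conjugate_le_conjugate h1 _
    rw [mul_one] at h2
    have h3 : 0 ≤ star (1 - v n * star (v n)) * a (n + 1) * (1 - v n * star (v n)) :=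
      star_left_conjugate_nonneg (ha0 _) _
    have h4 : star (1 - v n * star (v n)) * a (n + 1) * (1 - v n * star (v n)) =
        a (n + 1) - v n * star (v n) := by
      have hQ : (v n * star (v n)) * (v n * star (v n)) = v n * star (v n) := by
        calc _ = v n * (star (v n) * v n) * star (v n) := by noncomm_ring
          _ = _ := by rw [hv, hvp]
      have k1 : a (n + 1) * (v n * star (v n)) = v n * star (v n) := by rw [← mul_assoc, hav]
      have k2 : (v n * star (v n)) * a (n + 1) = v n * star (v n) := by rw [mul_assoc, hvsa]
      rw [star_sub, star_one, star_mul, star_star, sub_mul, one_mul, k2, mul_sub, mul_one, sub_mul, k1, hQ]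
      abel
    rw [h4, sub_nonneg] at h3
    exact sub_nonneg.2 (h2.trans h3)
  have hg : ∀ n, ∃ g ∈ B, star g * g = e n := fun n => exists_sqrt hB (heB n) (he0 n)
  choose g hgB hge using hg
  have hgp : ∀ n, g n * p (n + 1) = g n := by
    intro n
    have : g n * (1 - p (n + 1)) = 0 := by
      apply g_kill (hge n)
      simp only [e]
      rw [mul_sub, mul_one, sub_mul, hap, mul_assoc (v n * a n), hvsp, sub_self]
    rw [mul_sub, mul_one, sub_eq_zero] at this; exact this.symm
  have hgv : ∀ n, g (n + 1) * (v (n + 1) * v n) = 0 := by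
    intro n
    apply g_kill (hge _)
    have : e (n + 1) * (v (n + 1) * v n) = (a (n + 2) * v (n + 1)) * v n
        - v (n + 1) * a (n + 1) * (star (v (n + 1)) * v (n + 1)) * v n := by
      simp only [e]; noncomm_ring
    rw [this, hav, hv, mul_assoc (v (n + 1)) (a (n + 1)), hap, mul_assoc (v (n + 1)), hav, sub_self]
  let L : ℕ → H →L[ℂ] H := fun n => Nat.rec 0 (fun n Ln => Ln * star (v n) + t n * g n) n
  have hL0 : L 0 = 0 := rfl
  have hLs : ∀ n, L (n + 1) = L n * star (v n) + t n * g n := fun n => rfl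
  clear_value L
  have hLp : ∀ n, L n * p n = L n := by
    intro n
    cases n with
    | zero => rw [hL0, zero_mul]
    | succ n => rw [hLs, add_mul, mul_assoc, mul_assoc, hvsp, hgp]
  have hLB : ∀ n, L n ∈ B := by
    intro n
    induction n with
    | zero => rw [hL0]; exact hB.zero_mem
    | succ n ih =>
      rw [hLs]
      refine hB.add_mem ?_ ((htB n _ (hgB n)).1)
      have h1 : v n * star (L n) ∈ B := half_ext hB (hp n).1 (hvB n) (hB.star_mem ih) (by
        have := congrArg star (hLp n); rwa [star_mul, (hp _).1.star_eq] at this)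
      have := hB.star_mem h1
      rwa [star_mul, star_star] at this
  have htL : ∀ n k, n ≤ k → star (t k) * L n = 0 := by
    intro n
    induction n with
    | zero => intro k _; rw [hL0, mul_zero]
    | succ n ih =>
      intro k hk
      rw [hLs, mul_add, ← mul_assoc, ← mul_assoc, ih k (by omega), ht0 k n (by omega), zero_mul,
        zero_mul, add_zero]
  have hLL : ∀ n, star (L n) * L n = a n := by
    intro n
    induction n with
    | zero => rw [hL0, mul_zero, ha00]
    | succ n ih =>
      have k1 : star (L n) * t n = 0 := by
        have := congrArg star (htL n n le_rfl); rwa [star_mul, star_star, star_zero] at this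
      have : star (L (n + 1)) * L (n + 1) = v n * (star (L n) * L n) * star (v n)
          + v n * (star (L n) * t n) * g n + star (g n) * (star (t n) * L n) * star (v n)
          + star (g n) * (star (t n) * t n) * g n := by
        rw [hLs, star_add, star_mul, star_mul, star_star]; noncomm_ring
      rw [this, ih, k1, htL n n le_rfl, ht1, mul_one, hge]
      simp [e]
  have hLv : ∀ n, L (n + 1) * v n = L n + t n * g n * v n := by
    intro n
    rw [hLs, add_mul, mul_assoc, hv, hLp]
  refine ⟨fun n => L (n + 1) * v n, ?_, ?_, ?_, ?_⟩
  · intro n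
    simp only
    rw [star_mul, mul_assoc, ← mul_assoc (star (L _)), hLL, hav, hv]
  · intro n
    simp only
    rw [hLv (n + 1), add_mul, mul_assoc, mul_assoc, hgv, mul_zero, add_zero]
  · intro n b hb
    rw [mul_assoc]
    exact hB.mul_mem (hLB _) (hvB n b hb)
  · intro k m hkm
    have key : ∀ j, k < j → star (t k) * (L (j + 1) * v j) = star (t k) * L j := by
      intro j hj
      rw [hLv, mul_add, ← mul_assoc, ← mul_assoc, ht0 k j (by omega), zero_mul, zero_mul, add_zero]
    simp only
    rw [key (m + 1) (by omega), key m hkm, hLs, mul_add, ← mul_assoc, ← mul_assoc, ht0 k m (by omega),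
      zero_mul, add_zero]

theorem sot_sup {S : ℕ → H →L[ℂ] H} (hS : ∀ n, IsProjectionOp (S n))
    (hm : ∀ n, S (n + 1) * S n = S n) : ∃ s, IsProjectionOp s ∧ SOTTendsto S s := by
  have hcl : ∀ n, IsClosed ((S n).range : Set H) := fun n => by
    have : ((S n).range : Set H) = {x | S n x = x} := by
      ext x
      constructor
      · rintro ⟨y, rfl⟩
        exact congrArg (fun T : H →L[ℂ] H => T y) (hS n).2.eq
      · intro h; exact ⟨x, h⟩
    rw [this]
    exact isClosed_eq (S n).continuous continuous_id
  have : ∀ n, CompleteSpace ((S n).range) := fun n => (hcl n).completeSpace_coe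
  have hst : ∀ n, ((S n).range).starProjection = S n := by
    intro n
    ext x
    apply Submodule.eq_starProjection_of_mem_of_inner_eq_zero
    · exact ⟨x, rfl⟩
    · rintro w ⟨y, rfl⟩
      change inner ℂ (x - S n x) (S n y) = 0
      have hs : star (S n) = S n := (hS n).1.star_eq
      rw [ContinuousLinearMap.star_eq_adjoint] at hs
      rw [← ContinuousLinearMap.adjoint_inner_left, hs, map_sub]
      have : S n (S n x) = S n x := congrArg (fun T : H →L[ℂ] H => T x) (hS n).2.eq
      rw [this, sub_self, inner_zero_left]
  have hmono : Monotone fun n => (S n).range := by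
    refine monotone_nat_of_le_succ fun n => ?_
    rintro x ⟨y, rfl⟩
    exact ⟨S n y, congrArg (fun T : H →L[ℂ] H => T y) (hm n)⟩
  refine ⟨_, starProj_isProj ((⨆ n, (S n).range).topologicalClosure), fun x => ?_⟩
  have := Submodule.starProjection_tendsto_closure_iSup (fun n => (S n).range) hmono x
  simpa only [hst] using this

theorem sot_eq {S : ℕ → H →L[ℂ] H} {s T R : H →L[ℂ] H} (h : SOTTendsto S s) (N : ℕ)
    (hR : ∀ m, N ≤ m → S m * T = R) : s * T = R := by
  ext x
  refine tendsto_nhds_unique (h (T x)) ?_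
  refine tendsto_const_nhds.congr' ?_
  filter_upwards [eventually_ge_atTop N] with m hm
  rw [← hR m hm]; rfl

theorem norm_proj_le {p : H →L[ℂ] H} (hp : IsProjectionOp p) : ‖p‖ ≤ 1 :=
  (CStarAlgebra.norm_le_one_iff_of_nonneg p (proj_nonneg hp)).2 (proj_le_one hp)

theorem norm_iso_le {v p : H →L[ℂ] H} (hp : IsProjectionOp p) (h : star v * v = p) : ‖v‖ ≤ 1 := by
  have h1 : ‖v‖ * ‖v‖ ≤ 1 := by
    rw [← CStarRing.norm_star_mul_self, h]; exact norm_proj_le hp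
  nlinarith [norm_nonneg v]

/-- **Statement 11.** Let `B` be a separable stable C*-algebra (playing the role of
`A ⊗ K` for a separable C*-algebra `A`, realized nondegenerately on a Hilbert space).
Every sequence `(p_n)` of open projections in `B** = (A ⊗ K)**` with
`p_n ≺≺ p_{n+1}` (compact subequivalence) for all `n` has a supremum of its classes
`[p_n]` in `Cu(A)`: there is an open projection `s` whose class is the least upper
bound of the classes `[p_n]` for the Cuntz order. -/
theorem sup_of_compactly_subequivalent_sequence
    {H : Type*} [NormedAddCommGroup H] [InnerProductSpace ℂ H] [CompleteSpace H]
    (B : Set (H →L[ℂ] H)) (hB : IsCStarSubalg B)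
    (hsep : TopologicalSpace.IsSeparable B) (hnd : Nondegenerate B)
    (hstable : IsStableAlg B)
    (p : ℕ → H →L[ℂ] H) (hopen : ∀ n, IsOpenProjection B (p n))
    (hsub : ∀ n, CompactSubequiv B (p n) (p (n + 1))) :
    ∃ s : H →L[ℂ] H, IsOpenProjection B s ∧ (∀ n, CuLE B (p n) s) ∧
      ∀ r, IsOpenProjection B r → (∀ n, CuLE B (p n) r) → CuLE B s r := by
  obtain ⟨t, htB, ht1, ht0, htS⟩ := hstable
  have hp : ∀ n, IsProjectionOp (p n) := fun n => (hopen n).1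
  choose q hqo hqc hqz using hsub
  choose v _ hv hvq hvB _ using hqz
  have hel := fun n => compact_elim (hqo n).1 (hqc n)
  choose a' ha' ha'0 ha'1 hqa using hel
  let a : ℕ → H →L[ℂ] H := fun n => Nat.casesOn n 0 a'
  have ha00 : a 0 = 0 := rfl
  have has : ∀ n, a (n + 1) = a' n := fun n => rfl
  clear_value a
  have ha : ∀ n, a n ∈ her B (p n) := by
    rintro (_ | n)
    · rw [ha00]; exact ⟨hB.zero_mem, by simp⟩
    · rw [has]; exact ha' n
  have ha0 : ∀ n, 0 ≤ a n := by
    rintro (_ | n)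
    · rw [ha00]
    · rw [has]; exact ha'0 n
  have ha1 : ∀ n, ‖a n‖ ≤ 1 := by
    rintro (_ | n)
    · rw [ha00]; simp
    · rw [has]; exact ha'1 n
  have hasa : ∀ n, star (a n) = a n := fun n => (IsSelfAdjoint.of_nonneg (ha0 n)).star_eq
  have hvp : ∀ n, v n * p n = v n := fun n => iso_mul (hp n) (hv n)
  have hav : ∀ n, a (n + 1) * v n = v n := by
    intro n
    have h1 : a' n * q n = q n := by
      have := congrArg star (hqa n)
      rwa [star_mul, (hqo n).1.1.star_eq, (IsSelfAdjoint.of_nonneg (ha'0 n)).star_eq] at this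
    have h2 : q n * v n = v n := by rw [← hvq, mul_assoc, hv, hvp]
    rw [has, ← h2, ← mul_assoc, h1]
  have hpa : ∀ n, p n * a n = a n := fun n => by
    calc p n * a n = p n * (p n * a n * p n) := by rw [(ha n).2]
      _ = (p n * p n) * a n * p n := by noncomm_ring
      _ = a n := by rw [(hp n).2.eq, (ha n).2]
  have hap : ∀ n, a n * p n = a n := fun n => by
    have := congrArg star (hpa n); rwa [star_mul, hasa, (hp n).1.star_eq] at this
  have hpv : ∀ n, p (n + 1) * v n = v n := fun n => by
    calc p (n + 1) * v n = (p (n + 1) * a (n + 1)) * v n := by rw [mul_assoc, hav]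
      _ = v n := by rw [hpa, hav]
  obtain ⟨V, hV, hVv, hVB, htV⟩ := tower hB hp hv hvB ha ha00 ha0 ha1 hav htB ht1 ht0
  have hVp : ∀ n, V n * p n = V n := fun n => iso_mul (hp n) (hV n)
  have hpV : ∀ n, p n * star (V n) = star (V n) := fun n => by
    have := congrArg star (hVp n); rwa [star_mul, (hp n).1.star_eq] at this
  have hVconj : ∀ n, ∀ b ∈ B, p n * b = b → V n * b ∈ B := fun n b hb hpb =>
    half_ext hB (hp n).1 (hVB n) hb hpb
  have hVn : ∀ n, ‖V n‖ ≤ 1 := fun n => norm_iso_le (hp n) (hV n)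
  have hVsn : ∀ n, ‖star (V n)‖ ≤ 1 := fun n => by rw [norm_star]; exact hVn n
  have hVV : ∀ n, star (V (n + 1)) * V n = v n := by
    intro n; rw [← hVv n, ← mul_assoc, hV, hpv]
  -- the increasing projections
  let S : ℕ → H →L[ℂ] H := fun n => V n * star (V n)
  have hSV : ∀ n, S n * V n = V n := fun n => by simp only [S]; rw [mul_assoc, hV, hVp]
  have hS : ∀ n, IsProjectionOp (S n) := by
    intro n
    refine ⟨IsSelfAdjoint.mul_star_self _, ?_⟩
    change S n * (V n * star (V n)) = _
    rw [← mul_assoc, hSV]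
  have hSm : ∀ n, S (n + 1) * S n = S n := by
    intro n
    change S (n + 1) * (V n * star (V n)) = V n * star (V n)
    rw [← mul_assoc, ← hVv n, ← mul_assoc, hSV]
  have hSmm : ∀ m n, n ≤ m → S m * S n = S n := by
    intro m n hnm
    induction m, hnm using Nat.le_induction with
    | base => exact (hS n).2.eq
    | succ m _ ih => rw [← ih, ← mul_assoc, hSm]
  obtain ⟨s, hsp, hslim⟩ := sot_sup hS hSm
  have hsS : ∀ n, s * S n = S n := fun n => sot_eq hslim n fun m hm => hSmm m n hm
  have hSs : ∀ n, S n * s = S n := fun n => by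
    have := congrArg star (hsS n); rwa [star_mul, (hS n).1.star_eq, hsp.1.star_eq] at this
  have hsV : ∀ n, s * V n = V n := fun n => by rw [← hSV n, ← mul_assoc, hsS]
  have hVs : ∀ n, star (V n) * s = star (V n) := fun n => by
    have := congrArg star (hsV n); rwa [star_mul, hsp.1.star_eq] at this
  -- conjugates by V n
  have hconj : ∀ n, ∀ b ∈ her B (p n), star b = b → V n * b * star (V n) ∈ her B s := by
    intro n b hb hbs
    have hpb : p n * b = b := by
      calc p n * b = p n * (p n * b * p n) := by rw [hb.2]
        _ = (p n * p n) * b * p n := by noncomm_ring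
        _ = b := by rw [(hp n).2.eq, hb.2]
    have h1 : star (V n * b) ∈ B := hB.star_mem (hVB n b hb)
    rw [star_mul, hbs] at h1
    refine ⟨?_, ?_⟩
    · rw [mul_assoc]
      exact hVconj n _ h1 (by rw [← mul_assoc, hpb])
    · calc s * (V n * b * star (V n)) * s = (s * V n) * b * (star (V n) * s) := by noncomm_ring
        _ = _ := by rw [hsV, hVs]
  have hnconj : ∀ n (b : H →L[ℂ] H), ‖b‖ ≤ 1 → ‖V n * b * star (V n)‖ ≤ 1 := by
    intro n b hb
    calc _ ≤ ‖V n‖ * ‖b‖ * ‖star (V n)‖ :=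
          (norm_mul_le _ _).trans (mul_le_mul_of_nonneg_right (norm_mul_le _ _) (norm_nonneg _))
      _ ≤ 1 * 1 * 1 := by
          gcongr
          · exact hVn n
          · exact hVsn n
      _ = 1 := by norm_num
  -- s is open
  have hcS : ∀ n, V (n + 1) * a (n + 1) * star (V (n + 1)) * V n = V n := by
    intro n
    rw [mul_assoc, hVV, mul_assoc, hav, hVv]
  have hso : IsOpenProjection B s := by
    let c : ℕ → H →L[ℂ] H := fun n => V n * a n * star (V n)
    have hc0 : ∀ n, 0 ≤ c n := fun n => star_right_conjugate_nonneg (ha0 n) _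
    have hcsa : ∀ n, star (c n) = c n := fun n => (IsSelfAdjoint.of_nonneg (hc0 n)).star_eq
    have hcs : ∀ n, c n * s = c n := fun n => by simp only [c]; rw [mul_assoc, hVs]
    have hle1 : ∀ n, c n ≤ S n := by
      intro n
      have h1 : a n ≤ 1 := (CStarAlgebra.norm_le_one_iff_of_nonneg (a n) (ha0 n)).1 (ha1 n)
      have := star_right_conjugate_le_conjugate h1 (V n)
      rwa [mul_one] at this
    have hcS' : ∀ n, c (n + 1) * S n = S n := by
      intro n
      simp only [c, S]
      rw [← mul_assoc, hcS]
    have hScS : ∀ n, S n * c (n + 1) = S n := fun n => by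
      have := congrArg star (hcS' n); rwa [star_mul, (hS n).1.star_eq, hcsa] at this
    have hle2 : ∀ n, S n ≤ c (n + 1) := by
      intro n
      have h3 : 0 ≤ star (1 - S n) * c (n + 1) * (1 - S n) :=
        star_left_conjugate_nonneg (hc0 _) _
      have h4 : star (1 - S n) * c (n + 1) * (1 - S n) = c (n + 1) - S n := by
        rw [star_sub, star_one, (hS n).1.star_eq, sub_mul, one_mul, hScS, mul_sub, mul_one, sub_mul,
          hcS', (hS n).2.eq]
        abel
      rwa [h4, sub_nonneg] at h3
    have hmono : Monotone c := monotone_nat_of_le_succ fun n => (hle1 n).trans (hle2 n)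
    refine ⟨hsp, ℕ, (· ≤ ·), c, ⟨0⟩, fun i => le_refl i, fun i j k => le_trans,
      fun i j => ⟨max i j, le_max_left _ _, le_max_right _ _⟩,
      fun i => (hconj i _ (ha i) (hasa i)).1,
      fun i => (ContinuousLinearMap.nonneg_iff_isPositive _).1 (hc0 i),
      fun i j hij => hmono hij, ?_⟩
    intro x ε hε
    obtain ⟨N, hN⟩ := Metric.tendsto_atTop.1 (hslim x) (ε / 2) (by positivity)
    refine ⟨N + 1, fun j hj => ?_⟩
    obtain ⟨n, rfl⟩ : ∃ n, j = n + 1 := ⟨j - 1, by omega⟩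
    have hd := hN n (by omega)
    rw [dist_eq_norm] at hd
    have e : c (n + 1) x - s x = c (n + 1) (s x - S n x) + (S n x - s x) := by
      have e1 : c (n + 1) (s x) = c (n + 1) x := congrArg (fun T : H →L[ℂ] H => T x) (hcs (n + 1))
      have e2 : c (n + 1) (S n x) = S n x := congrArg (fun T : H →L[ℂ] H => T x) (hcS' n)
      rw [map_sub, e1, e2]; abel
    rw [e]
    calc _ ≤ ‖c (n + 1) (s x - S n x)‖ + ‖S n x - s x‖ := norm_add_le _ _
      _ ≤ ‖c (n + 1)‖ * ‖s x - S n x‖ + ‖S n x - s x‖ := by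
        gcongr; exact ContinuousLinearMap.le_opNorm _ _
      _ ≤ 1 * ‖s x - S n x‖ + ‖S n x - s x‖ := by
        gcongr; exact hnconj _ _ (ha1 _)
      _ < ε := by rw [norm_sub_rev (s x)]; linarith
  refine ⟨s, hso, ?_, ?_⟩
  · -- upper bound
    intro n p' hp' hc
    obtain ⟨b, hb, hb0, hb1, hpb⟩ := compact_elim hp'.1 hc
    have hbs : star b = b := (IsSelfAdjoint.of_nonneg hb0).star_eq
    have hbp : b * p' = p' := by
      have := congrArg star hpb; rwa [star_mul, hp'.1.1.star_eq, hbs] at this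
    have hpnb : p n * b = b := by
      calc p n * b = p n * (p n * b * p n) := by rw [hb.2]
        _ = (p n * p n) * b * p n := by noncomm_ring
        _ = b := by rw [(hp n).2.eq, hb.2]
    have hbpn : b * p n = b := by
      have := congrArg star hpnb; rwa [star_mul, (hp n).1.star_eq, hbs] at this
    have hyy : star (V n * b) * (V n * b) * p' = p' := by
      calc _ = b * (star (V n) * V n) * (b * p') := by rw [star_mul, hbs]; noncomm_ring
        _ = p' := by rw [hV, hbpn, hbp, hbp]
    obtain ⟨h1, h2⟩ := pz_of_y hB hp' (hVB n b hb) hyy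
    refine ⟨_, h1, ?_, h2⟩
    refine compact_of hB hsep hnd h1.1 (hconj n b hb hbs) (star_right_conjugate_nonneg hb0 _)
      (hnconj n b hb1) ?_
    calc V n * b * p' * star (V n * b) * (V n * b * star (V n))
        = V n * b * p' * b * (star (V n) * V n) * b * star (V n) := by
          rw [star_mul, hbs]; noncomm_ring
      _ = V n * b * (p' * b) * (p n * b) * star (V n) := by rw [hV]; noncomm_ring
      _ = V n * b * (p' * b) * star (V n) := by rw [hpb, hpnb, mul_assoc (V n * b), hpb]
      _ = V n * b * p' * star (V n * b) := by rw [star_mul, hbs]; noncomm_ring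
  · -- least
    intro r hr hle s' hs' hc
    obtain ⟨b, hb, hb0, hb1, hsb⟩ := compact_elim hs'.1 hc
    have hbs : star b = b := (IsSelfAdjoint.of_nonneg hb0).star_eq
    have hbs' : b * s' = s' := by
      have := congrArg star hsb; rwa [star_mul, hs'.1.1.star_eq, hbs] at this
    have hsbb : s * b = b := by
      calc s * b = s * (s * b * s) := by rw [hb.2]
        _ = (s * s) * b * s := by noncomm_ring
        _ = b := by rw [hsp.2.eq, hb.2]
    have hst : ∀ k, s * t k = S (k + 1) * t k := by
      intro k
      refine sot_eq hslim (k + 1) fun m hm => ?_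
      induction m, hm using Nat.le_induction with
      | base => rfl
      | succ m hm ih =>
        rw [← ih]
        have h1 : star (t k) * S (m + 1) = star (t k) * S m := by
          simp only [S]
          rw [← mul_assoc, htV k m (by omega), mul_assoc, ← star_mul, hVv, mul_assoc]
        have := congrArg star h1
        rwa [star_mul (star (t k)) (S (m + 1)), star_mul (star (t k)) (S m), star_star,
          (hS _).1.star_eq, (hS _).1.star_eq] at this
    obtain ⟨m, hm⟩ := htS b hb.1 (1 / 16) (by norm_num)
    have hmb := (hm m le_rfl).1
    set P := ∑ n ∈ Finset.range m, t n * star (t n) with hP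
    set N := m + 1 with hN
    set c := V N * (a N * a N) * star (V N) with hcdef
    have hcs : star c = c := by
      rw [hcdef, star_mul, star_mul, star_mul, star_star, hasa, mul_assoc, mul_assoc, mul_assoc]
    have hcn : ‖c‖ ≤ 1 := hnconj N _ (by
      calc _ ≤ ‖a N‖ * ‖a N‖ := norm_mul_le _ _
        _ ≤ 1 * 1 := by gcongr <;> exact ha1 N
        _ = 1 := by norm_num)
    have hcV : c * V m = V m := by
      rw [hcdef, hN, mul_assoc, hVV, mul_assoc, mul_assoc, hav, hav, hVv]
    have hcSm : c * S m = S m := by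
      simp only [S]; rw [← mul_assoc, hcV]
    have hcSk : ∀ k, k < m → (1 - c) * S (k + 1) = 0 := by
      intro k hk
      rw [← hSmm m (k + 1) hk, sub_mul, one_mul, ← mul_assoc c, hcSm, sub_self]
    have hkill : (1 - c) * s * P = 0 := by
      rw [hP, Finset.mul_sum]
      refine Finset.sum_eq_zero fun k hk => ?_
      rw [← mul_assoc, mul_assoc (1 - c), hst, ← mul_assoc (1 - c),
        hcSk k (Finset.mem_range.1 hk), zero_mul, zero_mul]
    have hsmall : ‖(1 - c) * b‖ ≤ 1 / 8 := by
      have e : (1 - c) * b = (1 - c) * (s * (1 * b - P * b)) := by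
        calc (1 - c) * b = (1 - c) * (s * b) := by rw [hsbb]
          _ = (1 - c) * (s * b) - ((1 - c) * s * P) * b := by rw [hkill, zero_mul, sub_zero]
          _ = _ := by noncomm_ring
      rw [e]
      have h1c : ‖1 - c‖ ≤ 2 := by
        have h1 : ‖(1 : H →L[ℂ] H)‖ ≤ 1 := ContinuousLinearMap.norm_id_le
        calc _ ≤ ‖(1 : H →L[ℂ] H)‖ + ‖c‖ := norm_sub_le _ _
          _ ≤ 2 := by linarith
      calc _ ≤ ‖1 - c‖ * (‖s‖ * ‖1 * b - P * b‖) :=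
            (norm_mul_le _ _).trans (mul_le_mul_of_nonneg_left (norm_mul_le _ _) (norm_nonneg _))
        _ ≤ 2 * (1 * (1 / 16)) := by
            rw [norm_sub_rev (1 * b)]
            gcongr
            exact norm_proj_le hsp
        _ = 1 / 8 := by norm_num
    obtain ⟨G, φ, hG, hφ1, hφ2, hφs, haφ, hkey⟩ := cutoff_abs b hb0 c hsmall hb1 hcs
    have hGM : G ∈ multiplierSet B := by rw [hG]; exact cfc_mult hB _ hb.1
    have hfB : b * φ ∈ B := by
      have e : b * φ = b - (b - b * b) * G := by rw [hφ1]; noncomm_ring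
      rw [e]
      exact hB.sub_mem hb.1 (hGM _ (hB.sub_mem hb.1 (hB.mul_mem hb.1 hb.1))).2
    have hφs' : φ * s' = s' := by
      rw [hφ2, sub_mul, one_mul, mul_assoc, sub_mul, one_mul, hbs', sub_self, mul_zero, sub_zero]
    have hfs' : b * φ * s' = s' := by rw [mul_assoc, hφs', hbs']
    have hfs : star (b * φ) = b * φ := by rw [star_mul, hφs, hbs, haφ]
    generalize hf : b * φ = f at *
    have haV : a N * star (V N) ∈ B := by
      have := hB.star_mem (hVB N _ (ha N)); rwa [star_mul, hasa] at this
    have hx1 : v N * (a N * star (V N)) ∈ B :=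
      half_ext hB (hp N).1 (hvB N) haV (by rw [← mul_assoc, hpa])
    have hxB : v N * (a N * star (V N)) * f ∈ B := hB.mul_mem hx1 hfB
    have hxx : star (v N * (a N * star (V N)) * f) * (v N * (a N * star (V N)) * f) = f * c * f := by
      calc _ = f * (V N * (a N * (star (v N) * v N) * a N) * star (V N)) * f := by
            rw [star_mul, star_mul, star_mul, star_star, hasa, hfs]; noncomm_ring
        _ = _ := by rw [hv, hap]
    obtain ⟨y, hyB, hyy, hya⟩ := polar hB hxB hfB hfs (by rw [hxx]; exact hkey)
    have hay : a (N + 1) * y = y := hya _ (by rw [← mul_assoc, ← mul_assoc, hav])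
    obtain ⟨h1, h2⟩ := pz_of_y hB hs' hyB (by rw [hyy, mul_assoc, hfs', hfs'])
    have hya' : star y * a (N + 1) = star y := by
      have := congrArg star hay; rwa [star_mul, hasa] at this
    have h3 : IsCompactlyContained B (y * s' * star y) (p (N + 1)) :=
      compact_of hB hsep hnd h1.1 (ha _) (ha0 _) (ha1 _) (by rw [mul_assoc, hya'])
    obtain ⟨r', hr'o, hr'c, hr'z⟩ := hle (N + 1) _ h1 h3
    exact ⟨r', hr'o, hr'c, pz_trans hB hs' h1.1 h2 hr'z⟩

end CuntzOP
end
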